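/- arXiv:1211.6567 — 10 statements merged into one kernel-verified Lean document; each statement's English description precedes it below -/
import Mathlib

section
/- If $A$ and $B$ are finite sets of real numbers, then the number of triples $(a,b,c)$ with $a \in A$, $b \in B$, $c \in A \cup B$, and $a + b = 2c$, is at most $0.15(|A|+|B|)^2 + 0.5(|A|+|B|)$. -/
open Finset in
/-- Pairs from `X × Y` whose midpoint lies in `Z`. -/
noncomputable def midPairs (X Y Z : Finset ℝ) : Finset (ℝ × ℝ) :=
  (X ×ˢ Y).filter (fun p => (p.1 + p.2) / 2 ∈ Z)

lemma mem_midPairs {X Y Z : Finset ℝ} {p : ℝ × ℝ} :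
    p ∈ midPairs X Y Z ↔ (p.1 ∈ X ∧ p.2 ∈ Y) ∧ (p.1 + p.2) / 2 ∈ Z := by
  simp [midPairs]

lemma midPairs_le_mul (X Y Z : Finset ℝ) : (midPairs X Y Z).card ≤ X.card * Y.card := by
  rw [← Finset.card_product]
  exact Finset.card_filter_le _ _

lemma midPairs_le_left (X Y Z : Finset ℝ) : (midPairs X Y Z).card ≤ Z.card * X.card := by
  rw [← Finset.card_product]
  apply Finset.card_le_card_of_injOn (fun p => ((p.1 + p.2) / 2, p.1))
  · intro p hp
    have := mem_midPairs.1 hp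
    simp [this.1.1, this.2]
  · rintro ⟨a, b⟩ _ ⟨c, d⟩ _ h
    simp only [Prod.mk.injEq] at h ⊢
    constructor <;> linarith [h.1, h.2]

lemma midPairs_le_right (X Y Z : Finset ℝ) : (midPairs X Y Z).card ≤ Z.card * Y.card := by
  rw [← Finset.card_product]
  apply Finset.card_le_card_of_injOn (fun p => ((p.1 + p.2) / 2, p.2))
  · intro p hp
    have := mem_midPairs.1 hp
    simp [this.1.2, this.2]
  · rintro ⟨a, b⟩ _ ⟨c, d⟩ _ h
    simp only [Prod.mk.injEq] at h ⊢
    constructor <;> linarith [h.1, h.2]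

/-- Removing the hook formed by the row of the minimum of `X` and the column of the maximum of
`Y`. -/
lemma midPairs_hook (X Y Z : Finset ℝ) (hX : X.Nonempty) (hY : Y.Nonempty) :
    (midPairs X Y Z).card ≤
      (midPairs (X.erase (X.min' hX)) (Y.erase (Y.max' hY)) Z).card + Z.card := by
  set x := X.min' hX
  set y := Y.max' hY
  have hx : ∀ a ∈ X, x ≤ a := fun a ha => X.min'_le a ha
  have hy : ∀ b ∈ Y, b ≤ y := fun b hb => Y.le_max' b hb
  set H := (midPairs X Y Z).filter (fun p => p.1 = x ∨ p.2 = y) with hH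
  have h1 : midPairs X Y Z ⊆ midPairs (X.erase x) (Y.erase y) Z ∪ H := by
    intro p hp
    have h := mem_midPairs.1 hp
    by_cases hc : p.1 = x ∨ p.2 = y
    · exact Finset.mem_union_right _ (Finset.mem_filter.2 ⟨hp, hc⟩)
    · push Not at hc
      refine Finset.mem_union_left _ (mem_midPairs.2 ⟨⟨?_, ?_⟩, h.2⟩)
      · exact Finset.mem_erase.2 ⟨hc.1, h.1.1⟩
      · exact Finset.mem_erase.2 ⟨hc.2, h.1.2⟩
  have h2 : H.card ≤ Z.card := by
    apply Finset.card_le_card_of_injOn (fun p => (p.1 + p.2) / 2)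
    · intro p hp
      exact (mem_midPairs.1 (Finset.mem_filter.1 hp).1).2
    · rintro ⟨a, b⟩ hp ⟨c, d⟩ hq h
      have hp' := Finset.mem_filter.1 hp
      have hq' := Finset.mem_filter.1 hq
      have hp1 := (mem_midPairs.1 hp'.1).1
      have hq1 := (mem_midPairs.1 hq'.1).1
      have e1 := hx _ hp1.1
      have e2 := hx _ hq1.1
      have e3 := hy _ hp1.2
      have e4 := hy _ hq1.2
      simp only at h e1 e2 e3 e4
      have o1 := hp'.2
      have o2 := hq'.2
      simp only at o1 o2
      simp only [Prod.mk.injEq]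
      rcases o1 with o1 | o1 <;> rcases o2 with o2 | o2 <;> constructor <;> linarith
  calc _ ≤ _ := Finset.card_le_card h1
    _ ≤ _ := Finset.card_union_le _ _
    _ ≤ _ := by omega

lemma midPairs_quad (z : ℕ) : ∀ (p : ℕ) (X Y Z : Finset ℝ), X.card = p → Z.card ≤ z →
    (X.card : ℝ) - Y.card ≤ z → (Y.card : ℝ) - X.card ≤ z → z ≤ X.card + Y.card →
    ((midPairs X Y Z).card : ℝ) ≤ z * ((X.card : ℝ) + Y.card) / 2 - (z : ℝ) ^ 2 / 4
      - ((X.card : ℝ) - Y.card) ^ 2 / 4 + 1 / 4 := by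
  intro p
  induction p with
  | zero =>
    intro X Y Z hp hZ h1 h2 h3
    have hm : ((midPairs X Y Z).card : ℝ) ≤ X.card * Y.card := by
      exact_mod_cast midPairs_le_mul X Y Z
    have h3' : (z : ℝ) ≤ X.card + Y.card := by exact_mod_cast h3
    rw [hp] at *
    push_cast at *
    nlinarith
  | succ p ih =>
    intro X Y Z hp hZ h1 h2 h3
    by_cases hz : X.card + Y.card ≤ z + 1
    · have hm : ((midPairs X Y Z).card : ℝ) ≤ X.card * Y.card := by
        exact_mod_cast midPairs_le_mul X Y Z
      have h3' : (z : ℝ) ≤ X.card + Y.card := by exact_mod_cast h3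
      have h4' : (X.card : ℝ) + Y.card ≤ z + 1 := by exact_mod_cast hz
      nlinarith
    · push Not at hz
      have hX : X.Nonempty := Finset.card_pos.1 (by omega)
      have h1' : X.card ≤ z + Y.card := by
        have : (X.card : ℝ) ≤ z + Y.card := by linarith
        exact_mod_cast this
      have hY : Y.Nonempty := by
        apply Finset.card_pos.1
        omega
      have hh := midPairs_hook X Y Z hX hY
      have cX : (X.erase (X.min' hX)).card + 1 = X.card :=
        Finset.card_erase_add_one (X.min'_mem hX)
      have cY : (Y.erase (Y.max' hY)).card + 1 = Y.card :=
        Finset.card_erase_add_one (Y.max'_mem hY)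
      have cX' : (X.card : ℝ) = (X.erase (X.min' hX)).card + 1 := by exact_mod_cast cX.symm
      have cY' : (Y.card : ℝ) = (Y.erase (Y.max' hY)).card + 1 := by exact_mod_cast cY.symm
      have := ih (X.erase (X.min' hX)) (Y.erase (Y.max' hY)) Z (by omega) hZ
        (by linarith) (by linarith) (by omega)
      have hh' : ((midPairs X Y Z).card : ℝ) ≤
        (midPairs (X.erase (X.min' hX)) (Y.erase (Y.max' hY)) Z).card + Z.card := by
        exact_mod_cast hh
      have hZ' : (Z.card : ℝ) ≤ z := by exact_mod_cast hZ
      rw [cX', cY']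
      nlinarith

/-- The uniform bound. -/
lemma midPairs_bound (z : ℕ) (X Y Z : Finset ℝ) (hZ : Z.card ≤ z) :
    ((midPairs X Y Z).card : ℝ) ≤ z * ((X.card : ℝ) + Y.card) / 2 - (z : ℝ) ^ 2 / 4
      - ((X.card : ℝ) - Y.card) ^ 2 / 4 + 1 / 4
      + (max (|(X.card : ℝ) - Y.card| - z) 0) ^ 2 / 4
      + (max ((z : ℝ) - (X.card + Y.card)) 0) ^ 2 / 4 := by
  have hZ' : (Z.card : ℝ) ≤ z := by exact_mod_cast hZ
  have hm : ((midPairs X Y Z).card : ℝ) ≤ X.card * Y.card := by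
    exact_mod_cast midPairs_le_mul X Y Z
  have hl : ((midPairs X Y Z).card : ℝ) ≤ Z.card * X.card := by
    exact_mod_cast midPairs_le_left X Y Z
  have hr : ((midPairs X Y Z).card : ℝ) ≤ Z.card * Y.card := by
    exact_mod_cast midPairs_le_right X Y Z
  have hl' : ((midPairs X Y Z).card : ℝ) ≤ z * X.card :=
    hl.trans (mul_le_mul_of_nonneg_right hZ' (by positivity))
  have hr' : ((midPairs X Y Z).card : ℝ) ≤ z * Y.card :=
    hr.trans (mul_le_mul_of_nonneg_right hZ' (by positivity))
  have s1 := sq_nonneg (max (|(X.card : ℝ) - Y.card| - z) 0)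
  have s2 := sq_nonneg (max ((z : ℝ) - (X.card + Y.card)) 0)
  by_cases c1 : (z : ℝ) ≤ X.card + Y.card
  · by_cases c2 : |(X.card : ℝ) - Y.card| ≤ z
    · have := midPairs_quad z _ X Y Z rfl hZ (le_of_abs_le c2)
        (by linarith [neg_le_of_abs_le c2]) (by exact_mod_cast c1)
      linarith
    · push Not at c2
      rw [max_eq_left (by linarith : (0 : ℝ) ≤ |(X.card : ℝ) - Y.card| - z)] at *
      rcases le_total 0 ((X.card : ℝ) - Y.card) with h | h
      · rw [abs_of_nonneg h] at *
        nlinarith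
      · rw [abs_of_nonpos h] at *
        nlinarith
  · push Not at c1
    rw [max_eq_left (by linarith : (0 : ℝ) ≤ (z : ℝ) - (X.card + Y.card))] at *
    nlinarith

lemma claim_one (g g' w e : ℝ) (h : g + g' = 2 * w) (he : e ≤ w) :
    g * g' / 2 + (max (e - g) 0) ^ 2 / 4 + (max (e - g') 0) ^ 2 / 4 ≤ w ^ 2 / 2 := by
  obtain rfl : g' = 2 * w - g := by linarith
  rcases le_total (e - g) 0 with h1 | h1 <;> rcases le_total (e - (2 * w - g)) 0 with h2 | h2 <;>
    simp only [h1, h2, max_eq_left, max_eq_right] <;> nlinarith [sq_nonneg (g - w)]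

lemma claim_two (a b d e : ℝ) (h : a + b = 2 * d) (hd : 0 ≤ d) (he : 0 ≤ e) :
    (max (|a| - e) 0) ^ 2 / 4 + (max (|b| - e) 0) ^ 2 / 4 - (a - b) ^ 2 / 4
      ≤ (max (d - e) 0) ^ 2 / 2 := by
  wlog hab : b ≤ a generalizing a b
  · have := this b a (by linarith) (by linarith)
    nlinarith
  obtain ⟨s, rfl⟩ : ∃ s, a = d + s := ⟨a - d, by ring⟩
  obtain rfl : b = d - s := by linarith
  have hs : 0 ≤ s := by linarith
  rw [abs_of_nonneg (by linarith : 0 ≤ d + s)]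
  have hpos := sq_nonneg (max (d - e) 0)
  rcases le_total 0 (d - s) with h0 | h0
  · rw [abs_of_nonneg h0]
    rcases le_total (d + s - e) 0 with h1 | h1 <;> rcases le_total (d - s - e) 0 with h2 | h2 <;>
    rcases le_total (d - e) 0 with h3 | h3 <;>
      simp only [h1, h2, h3, max_eq_left, max_eq_right] <;> nlinarith
  · rw [abs_of_nonpos h0]
    rcases le_total (d + s - e) 0 with h1 | h1 <;> rcases le_total (-(d - s) - e) 0 with h2 | h2 <;>
    rcases le_total (d - e) 0 with h3 | h3 <;>
      simp only [h1, h2, h3, max_eq_left, max_eq_right] <;> nlinarith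

lemma claim_three (d e N : ℝ) (he : 0 ≤ e) (hN : 0 ≤ N)
    (hdN : d ≤ 0.2 * N - 0.1 * e) :
    ((N - e) / 2) ^ 2 / 2 + e * ((N - e) / 2) - e ^ 2 / 4 + (max (d - e) 0) ^ 2 / 2
      ≤ 0.15 * N ^ 2 := by
  rcases le_total (d - e) 0 with h | h
  · simp only [h, max_eq_right]
    nlinarith [sq_nonneg (N - 5 * e)]
  · simp only [h, max_eq_left]
    have h1 : (d - e) ^ 2 ≤ (0.2 * N - 1.1 * e) ^ 2 := by
      apply pow_le_pow_left₀ h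
      linarith
    have h2 : 1.1 * e ≤ 0.2 * N := by linarith
    nlinarith

/-- The numerical inequality for the main case. -/
lemma numeric (x1 y1 x2 y2 e N c1 c2 : ℝ) (hN : N = x1 + y1 + x2 + y2 + e) (he : 0 ≤ e)
    (hN0 : 0 ≤ N) (huv : x2 + y2 ≤ x1 + y1) (hv : 0.3 * N - 0.4 * e ≤ x2 + y2)
    (heN : e ≤ (N - e) / 2)
    (h1 : c1 ≤ e * (x1 + y2) / 2 - e ^ 2 / 4 - (x1 - y2) ^ 2 / 4 + 1 / 4
      + (max (|x1 - y2| - e) 0) ^ 2 / 4 + (max (e - (x1 + y2)) 0) ^ 2 / 4)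
    (h2 : c2 ≤ e * (y1 + x2) / 2 - e ^ 2 / 4 - (y1 - x2) ^ 2 / 4 + 1 / 4
      + (max (|y1 - x2| - e) 0) ^ 2 / 4 + (max (e - (y1 + x2)) 0) ^ 2 / 4) :
    x1 * y1 + x2 * y2 + e ^ 2 / 4 + c1 + c2 ≤ 0.15 * N ^ 2 + 0.5 := by
  have k1 := claim_one (x1 + y2) (y1 + x2) ((N - e) / 2) e (by linarith) heN
  have k2 := claim_two (x1 - y2) (y1 - x2) ((x1 + y1 - x2 - y2) / 2) e (by linarith)
    (by linarith) he
  have k3 := claim_three ((x1 + y1 - x2 - y2) / 2) e N he hN0 (by linarith)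
  have id1 : x1 * y1 + x2 * y2 = (x1 + y2) * (y1 + x2) / 2 + (x1 - y2) * (y1 - x2) / 2 := by ring
  have id2 : e * (x1 + y2) / 2 + e * (y1 + x2) / 2 = e * ((N - e) / 2) := by rw [hN]; ring
  have id3 : (x1 - y2 - (y1 - x2)) ^ 2 / 4 = (x1 - y2) ^ 2 / 4 + (y1 - x2) ^ 2 / 4
    - (x1 - y2) * (y1 - x2) / 2 := by ring
  linarith

/-- A parity function on a finite set with at least two elements. -/
lemma exists_parity (C : Finset ℝ) (x y : ℝ) (hx : x ∈ C) (hy : y ∈ C) (hxy : x ≠ y) :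
    ∃ f : ℝ → ℤ, (∀ a ∈ C, ∀ b ∈ C, ∀ c ∈ C, a + b = 2 * c → f a + f b = 2 * f c) ∧
      (∃ u ∈ C, f u % 2 = 0) ∧ (∃ u ∈ C, f u % 2 = 1) := by
  classical
  let S : Set ℝ := (fun c => c - x) '' (C : Set ℝ)
  let H : Submodule ℤ ℝ := Submodule.span ℤ S
  have hS : S.Finite := C.finite_toSet.image _
  haveI : Module.Finite ℤ H := Module.Finite.span_of_finite ℤ hS
  have hmem : ∀ c ∈ C, c - x ∈ H := fun c hc => Submodule.subset_span ⟨c, hc, rfl⟩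
  let b := Module.Free.chooseBasis ℤ H
  haveI : Nontrivial H := ⟨⟨y - x, hmem y hy⟩, 0, by
    intro h
    have := congrArg Subtype.val h
    simp only [ZeroMemClass.coe_zero] at this
    exact hxy (by linarith)⟩
  haveI : Nonempty (Module.Free.ChooseBasisIndex ℤ H) := b.index_nonempty
  let i : Module.Free.ChooseBasisIndex ℤ H := Classical.arbitrary _
  let φ : H →ₗ[ℤ] ℤ := b.coord i
  let f : ℝ → ℤ := fun c => if h : c - x ∈ H then φ ⟨c - x, h⟩ else 0
  have hf : ∀ c (hc : c ∈ C), f c = φ ⟨c - x, hmem c hc⟩ := fun c hc => dif_pos (hmem c hc)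
  refine ⟨f, ?_, ⟨x, hx, ?_⟩, ?_⟩
  · intro a ha b' hb c hc h
    rw [hf a ha, hf b' hb, hf c hc, ← map_add, two_mul, ← map_add]
    congr 1
    apply Subtype.ext
    simp only [Submodule.coe_add]
    linarith
  · rw [hf x hx]
    have : (⟨x - x, hmem x hx⟩ : H) = 0 := Subtype.ext (by simp)
    rw [this, map_zero]
    rfl
  · by_contra hcon
    push Not at hcon
    have key : ∀ h (hh : h ∈ H), (2 : ℤ) ∣ φ ⟨h, hh⟩ := by
      intro h hh
      induction hh using Submodule.span_induction with
      | mem v hv =>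
        obtain ⟨c, hc, rfl⟩ := hv
        have := hcon c hc
        have e := hf c hc
        have e' : φ ⟨c - x, Submodule.subset_span ⟨c, hc, rfl⟩⟩ = f c := e.symm
        simp only
        rw [e']
        omega
      | zero =>
        have : (⟨0, H.zero_mem⟩ : H) = 0 := rfl
        rw [this, map_zero]
        exact dvd_zero _
      | add u v hu hv iu iv =>
        have : (⟨u + v, H.add_mem hu hv⟩ : H) = ⟨u, hu⟩ + ⟨v, hv⟩ := rfl
        rw [this, map_add]
        exact dvd_add iu iv
      | smul n u hu iu =>
        have : (⟨n • u, H.smul_mem n hu⟩ : H) = n • ⟨u, hu⟩ := rfl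
        rw [this, map_smul]
        exact Dvd.dvd.mul_left iu n
    have h1 : φ (b i) = 1 := by simp [φ]
    have := key (b i).1 (b i).2
    rw [Subtype.coe_eta, h1] at this
    omega

/-- Elements of `A` with `f ≡ r` modulo `m`. -/
noncomputable def cls (f : ℝ → ℤ) (m r : ℤ) (A : Finset ℝ) : Finset ℝ :=
  A.filter (fun a => f a % m = r)

lemma mem_cls {f : ℝ → ℤ} {m r : ℤ} {A : Finset ℝ} {a : ℝ} :
    a ∈ cls f m r A ↔ a ∈ A ∧ f a % m = r := by simp [cls]

lemma card_cls_two (f : ℝ → ℤ) (A : Finset ℝ) :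
    (cls f 2 0 A).card + (cls f 2 1 A).card = A.card := by
  rw [← Finset.card_filter_add_card_filter_not (s := A) (fun a => f a % 2 = 0)]
  congr 2
  apply Finset.filter_congr
  intro a _
  omega

lemma card_cls_four (f : ℝ → ℤ) (A : Finset ℝ) :
    (cls f 4 0 A).card + (cls f 4 2 A).card = (cls f 2 0 A).card := by
  rw [← Finset.card_filter_add_card_filter_not (s := cls f 2 0 A) (fun a => f a % 4 = 0)]
  congr 2
  · ext a
    simp only [mem_cls, Finset.mem_filter]
    constructor
    · rintro ⟨h, h'⟩
      exact ⟨⟨h, by omega⟩, h'⟩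
    · rintro ⟨⟨h, _⟩, h'⟩
      exact ⟨h, h'⟩
  · ext a
    simp only [mem_cls, Finset.mem_filter]
    constructor
    · rintro ⟨h, h'⟩
      exact ⟨⟨h, by omega⟩, by omega⟩
    · rintro ⟨⟨h, _⟩, h'⟩
      exact ⟨h, by omega⟩

lemma cls_union (f : ℝ → ℤ) (m r : ℤ) (A B : Finset ℝ) :
    cls f m r (A ∪ B) = cls f m r A ∪ cls f m r B := Finset.filter_union _ _ _

/-- First decomposition: midpoints in the even class are kept for the induction. -/
lemma decomp_one (A B : Finset ℝ) (f : ℝ → ℤ)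
    (hf : ∀ a ∈ A ∪ B, ∀ b ∈ A ∪ B, ∀ c ∈ A ∪ B, a + b = 2 * c → f a + f b = 2 * f c) :
    (midPairs A B (A ∪ B)).card ≤
      (midPairs (cls f 2 0 A) (cls f 2 0 B) (cls f 2 0 A ∪ cls f 2 0 B)).card
      + (cls f 2 1 A).card * (cls f 2 1 B).card
      + (midPairs (cls f 4 0 A) (cls f 4 2 B) (cls f 2 1 (A ∪ B))).card
      + (midPairs (cls f 4 0 B) (cls f 4 2 A) (cls f 2 1 (A ∪ B))).card := by
  classical
  have hsw : (midPairs (cls f 4 0 B) (cls f 4 2 A) (cls f 2 1 (A ∪ B))).card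
      = (midPairs (cls f 4 2 A) (cls f 4 0 B) (cls f 2 1 (A ∪ B))).card := by
    apply Finset.card_bij (fun p _ => (p.2, p.1))
    · intro p hp
      have := mem_midPairs.1 hp
      exact mem_midPairs.2 ⟨⟨this.1.2, this.1.1⟩, by rw [add_comm]; exact this.2⟩
    · rintro ⟨a, b⟩ _ ⟨c, d⟩ _ h
      simp only [Prod.mk.injEq] at h ⊢
      exact ⟨h.2, h.1⟩
    · intro p hp
      have := mem_midPairs.1 hp
      exact ⟨(p.2, p.1), mem_midPairs.2 ⟨⟨this.1.2, this.1.1⟩, by rw [add_comm]; exact this.2⟩, rfl⟩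
  rw [hsw, ← Finset.card_product]
  refine le_trans (Finset.card_le_card (t :=
    ((midPairs (cls f 2 0 A) (cls f 2 0 B) (cls f 2 0 A ∪ cls f 2 0 B)
      ∪ (cls f 2 1 A) ×ˢ (cls f 2 1 B))
      ∪ midPairs (cls f 4 0 A) (cls f 4 2 B) (cls f 2 1 (A ∪ B)))
      ∪ midPairs (cls f 4 2 A) (cls f 4 0 B) (cls f 2 1 (A ∪ B))) ?_) ?_
  · intro p hp
    obtain ⟨⟨ha, hb⟩, hc⟩ := mem_midPairs.1 hp
    have e := hf p.1 (Finset.mem_union_left _ ha) p.2 (Finset.mem_union_right _ hb) _ hc (by ring)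
    rw [← cls_union]
    simp only [Finset.mem_union (a := p), Finset.mem_product, mem_midPairs, mem_cls, ha, hb, hc,
      true_and]
    omega
  · refine (Finset.card_union_le _ _).trans (Nat.add_le_add_right ?_ _)
    refine (Finset.card_union_le _ _).trans (Nat.add_le_add_right ?_ _)
    exact Finset.card_union_le _ _

/-- Second decomposition. -/
lemma decomp_two (A B : Finset ℝ) (f : ℝ → ℤ)
    (hf : ∀ a ∈ A ∪ B, ∀ b ∈ A ∪ B, ∀ c ∈ A ∪ B, a + b = 2 * c → f a + f b = 2 * f c) :
    (midPairs A B (A ∪ B)).card ≤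
      (cls f 4 0 A).card * (cls f 4 0 B).card + (cls f 4 2 A).card * (cls f 4 2 B).card
      + (cls f 2 1 A).card * (cls f 2 1 B).card
      + (midPairs (cls f 4 0 A) (cls f 4 2 B) (cls f 2 1 (A ∪ B))).card
      + (midPairs (cls f 4 0 B) (cls f 4 2 A) (cls f 2 1 (A ∪ B))).card := by
  classical
  refine (decomp_one A B f hf).trans ?_
  gcongr
  rw [← Finset.card_product, ← Finset.card_product]
  refine le_trans (Finset.card_le_card (t :=
    (cls f 4 0 A) ×ˢ (cls f 4 0 B) ∪ (cls f 4 2 A) ×ˢ (cls f 4 2 B)) ?_)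
    (Finset.card_union_le _ _)
  intro p hp
  obtain ⟨⟨ha, hb⟩, hc⟩ := mem_midPairs.1 hp
  rw [← cls_union] at hc
  rw [mem_cls] at ha hb hc
  have e := hf p.1 (Finset.mem_union_left _ ha.1) p.2 (Finset.mem_union_right _ hb.1) _ hc.1
    (by ring)
  simp only [Finset.mem_union, Finset.mem_product, mem_cls, ha.1, hb.1, true_and]
  omega

/-- Induction step for a normalized parity function. -/
lemma step (A B : Finset ℝ) (f : ℝ → ℤ)
    (hf : ∀ a ∈ A ∪ B, ∀ b ∈ A ∪ B, ∀ c ∈ A ∪ B, a + b = 2 * c → f a + f b = 2 * f c)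
    (hodd : 0 < (cls f 2 1 A).card + (cls f 2 1 B).card)
    (hmin : (cls f 2 1 A).card + (cls f 2 1 B).card ≤ (cls f 2 0 A).card + (cls f 2 0 B).card)
    (huv : (cls f 4 2 A).card + (cls f 4 2 B).card ≤ (cls f 4 0 A).card + (cls f 4 0 B).card)
    (ih : ((midPairs (cls f 2 0 A) (cls f 2 0 B) (cls f 2 0 A ∪ cls f 2 0 B)).card : ℝ) ≤
      0.15 * (((cls f 2 0 A).card : ℝ) + (cls f 2 0 B).card) ^ 2
        + 0.5 * (((cls f 2 0 A).card : ℝ) + (cls f 2 0 B).card)) :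
    ((midPairs A B (A ∪ B)).card : ℝ) ≤
      0.15 * ((A.card : ℝ) + B.card) ^ 2 + 0.5 * ((A.card : ℝ) + B.card) := by
  have d1 : ((midPairs A B (A ∪ B)).card : ℝ) ≤ _ := Nat.cast_le.2 (decomp_one A B f hf)
  have d2 : ((midPairs A B (A ∪ B)).card : ℝ) ≤ _ := Nat.cast_le.2 (decomp_two A B f hf)
  have hz : (cls f 2 1 (A ∪ B)).card ≤ (cls f 2 1 A).card + (cls f 2 1 B).card := by
    rw [cls_union]
    exact Finset.card_union_le _ _
  have b1 := midPairs_bound _ (cls f 4 0 A) (cls f 4 2 B) (cls f 2 1 (A ∪ B)) hz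
  have b2 := midPairs_bound _ (cls f 4 0 B) (cls f 4 2 A) (cls f 2 1 (A ∪ B)) hz
  have p1 := Nat.cast_le (α := ℝ).2
    (midPairs_le_mul (cls f 4 0 A) (cls f 4 2 B) (cls f 2 1 (A ∪ B)))
  have p2 := Nat.cast_le (α := ℝ).2
    (midPairs_le_mul (cls f 4 0 B) (cls f 4 2 A) (cls f 2 1 (A ∪ B)))
  have r1 := Nat.cast_le (α := ℝ).2
    ((midPairs_le_right (cls f 4 0 A) (cls f 4 2 B) (cls f 2 1 (A ∪ B))).trans
      (Nat.mul_le_mul_right _ hz))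
  have r2 := Nat.cast_le (α := ℝ).2
    ((midPairs_le_right (cls f 4 0 B) (cls f 4 2 A) (cls f 2 1 (A ∪ B))).trans
      (Nat.mul_le_mul_right _ hz))
  rw [← card_cls_two f A, ← card_cls_two f B]
  rw [← card_cls_four f A, ← card_cls_four f B] at *
  generalize (midPairs (cls f 2 0 A) (cls f 2 0 B) (cls f 2 0 A ∪ cls f 2 0 B)).card = t0 at *
  generalize (midPairs (cls f 4 0 A) (cls f 4 2 B) (cls f 2 1 (A ∪ B))).card = c1 at *
  generalize (midPairs (cls f 4 0 B) (cls f 4 2 A) (cls f 2 1 (A ∪ B))).card = c2 at *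
  generalize (midPairs A B (A ∪ B)).card = t at *
  generalize (cls f 4 0 A).card = x1 at *
  generalize (cls f 4 0 B).card = y1 at *
  generalize (cls f 4 2 A).card = x2 at *
  generalize (cls f 4 2 B).card = y2 at *
  generalize (cls f 2 1 A).card = x3 at *
  generalize (cls f 2 1 B).card = y3 at *
  have hodd' : (1 : ℝ) ≤ (x3 : ℝ) + y3 := by exact_mod_cast hodd
  have hmin' : (x3 : ℝ) + y3 ≤ (x1 : ℝ) + x2 + (y1 + y2) := by exact_mod_cast hmin
  have huv' : (x2 : ℝ) + y2 ≤ (x1 : ℝ) + y1 := by exact_mod_cast huv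
  push_cast at *
  have q1 : (0 : ℝ) ≤ x1 := by positivity
  have q2 : (0 : ℝ) ≤ x2 := by positivity
  have q3 : (0 : ℝ) ≤ x3 := by positivity
  have q4 : (0 : ℝ) ≤ y1 := by positivity
  have q5 : (0 : ℝ) ≤ y2 := by positivity
  have q6 : (0 : ℝ) ≤ y3 := by positivity
  generalize (x1 : ℝ) = x1 at *
  generalize (y1 : ℝ) = y1 at *
  generalize (x2 : ℝ) = x2 at *
  generalize (y2 : ℝ) = y2 at *
  generalize (x3 : ℝ) = x3 at *
  generalize (y3 : ℝ) = y3 at *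
  obtain ⟨e, he⟩ : ∃ e, e = x3 + y3 := ⟨_, rfl⟩
  obtain ⟨N, hN⟩ : ∃ N, N = x1 + y1 + x2 + y2 + e := ⟨_, rfl⟩
  rw [← he] at b1 b2 r1 r2 hodd' hmin'
  have h33 : x3 * y3 ≤ e ^ 2 / 4 := by rw [he]; nlinarith [sq_nonneg (x3 - y3)]
  have hNN : x1 + x2 + x3 + (y1 + y2 + y3) = N := by rw [hN, he]; ring
  rw [hNN]
  have hM : x1 + x2 + (y1 + y2) = N - e := by rw [hN]; ring
  rw [hM] at ih hmin'
  by_cases cI : x2 + y2 ≤ 0.3 * N - 0.4 * e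
  · have : e * (x2 + y2) ≤ e * (0.3 * N - 0.4 * e) := mul_le_mul_of_nonneg_left cI (by linarith)
    have hexp1 : e * (x2 + y2) = e * x2 + e * y2 := by ring
    have hexp2 : e * (0.3 * N - 0.4 * e) = 0.3 * (e * N) - 0.4 * e ^ 2 := by ring
    have hexp3 : (N - e) ^ 2 = N ^ 2 - 2 * (e * N) + e ^ 2 := by ring
    rw [hexp3] at ih
    linarith
  push Not at cI
  by_cases cII : e ≤ (N - e) / 2
  · have := numeric x1 y1 x2 y2 e N c1 c2 hN (by linarith) (by linarith) huv' cI.le cII b1 b2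
    linarith
  · push Not at cII
    have h00 : (x1 + x2) * (y1 + y2) ≤ (N - e) ^ 2 / 4 := by
      rw [← hM]; nlinarith [sq_nonneg (x1 + x2 - (y1 + y2))]
    have : (N - e) ^ 2 / 4 + e ^ 2 / 4 ≤ 0.15 * N ^ 2 := by
      nlinarith [mul_nonneg (by linarith : 0 ≤ 3 * e - N) (by linarith : 0 ≤ N - 2 * e)]
    have hexp : (x1 + x2) * (y1 + y2) = x1 * y1 + x2 * y2 + x1 * y2 + y1 * x2 := by ring
    have hNpos : 0 ≤ N := by linarith
    linarith

lemma main_bound : ∀ (n : ℕ) (A B : Finset ℝ), A.card + B.card = n →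
    ((midPairs A B (A ∪ B)).card : ℝ) ≤
      0.15 * ((A.card : ℝ) + B.card) ^ 2 + 0.5 * ((A.card : ℝ) + B.card) := by
  intro n
  induction n using Nat.strong_induction_on with
  | _ n ih =>
  intro A B hn
  by_cases hC : (A ∪ B).card ≤ 1
  · have hA : A.card ≤ 1 := (Finset.card_le_card Finset.subset_union_left).trans hC
    have hB : B.card ≤ 1 := (Finset.card_le_card Finset.subset_union_right).trans hC
    have hm : ((midPairs A B (A ∪ B)).card : ℝ) ≤ A.card * B.card := by
      exact_mod_cast midPairs_le_mul A B _
    have hA' : (A.card : ℝ) ≤ 1 := by exact_mod_cast hA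
    have hB' : (B.card : ℝ) ≤ 1 := by exact_mod_cast hB
    have hA0 : (0 : ℝ) ≤ A.card := by positivity
    have hB0 : (0 : ℝ) ≤ B.card := by positivity
    nlinarith
  push Not at hC
  obtain ⟨x, hx, y, hy, hxy⟩ := Finset.one_lt_card.1 hC
  obtain ⟨f, hf, ⟨u, hu, hu0⟩, ⟨v, hv, hv1⟩⟩ := exists_parity (A ∪ B) x y hx hy hxy
  have pos : ∀ (g : ℝ → ℤ) (w : ℝ), w ∈ A ∪ B → g w % 2 = 1 →
      0 < (cls g 2 1 A).card + (cls g 2 1 B).card := by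
    intro g w hw hg
    rcases Finset.mem_union.1 hw with h | h
    · have : 0 < (cls g 2 1 A).card := Finset.card_pos.2 ⟨w, mem_cls.2 ⟨h, hg⟩⟩
      omega
    · have : 0 < (cls g 2 1 B).card := Finset.card_pos.2 ⟨w, mem_cls.2 ⟨h, hg⟩⟩
      omega
  -- normalize so that the even class is the larger one
  obtain ⟨g, hg, hgpos, hgmin⟩ : ∃ g : ℝ → ℤ,
      (∀ a ∈ A ∪ B, ∀ b ∈ A ∪ B, ∀ c ∈ A ∪ B, a + b = 2 * c → g a + g b = 2 * g c) ∧
      0 < (cls g 2 1 A).card + (cls g 2 1 B).card ∧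
      (cls g 2 1 A).card + (cls g 2 1 B).card ≤ (cls g 2 0 A).card + (cls g 2 0 B).card := by
    rcases le_total ((cls f 2 1 A).card + (cls f 2 1 B).card)
      ((cls f 2 0 A).card + (cls f 2 0 B).card) with h | h
    · exact ⟨f, hf, pos f v hv hv1, h⟩
    · have s1 : ∀ D : Finset ℝ, cls (fun t => f t + 1) 2 1 D = cls f 2 0 D := by
        intro D; ext a; simp only [mem_cls]; constructor <;> rintro ⟨p, q⟩ <;> exact ⟨p, by omega⟩
      have s2 : ∀ D : Finset ℝ, cls (fun t => f t + 1) 2 0 D = cls f 2 1 D := by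
        intro D; ext a; simp only [mem_cls]; constructor <;> rintro ⟨p, q⟩ <;> exact ⟨p, by omega⟩
      refine ⟨fun t => f t + 1, ?_, pos _ u hu (by omega), ?_⟩
      · intro a ha b hb c hc habc
        have := hf a ha b hb c hc habc
        simp only
        omega
      · rw [s1, s1, s2, s2]
        exact h
  obtain ⟨k, hk, hkpos, hkmin, hkuv⟩ : ∃ g : ℝ → ℤ,
      (∀ a ∈ A ∪ B, ∀ b ∈ A ∪ B, ∀ c ∈ A ∪ B, a + b = 2 * c → g a + g b = 2 * g c) ∧
      0 < (cls g 2 1 A).card + (cls g 2 1 B).card ∧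
      (cls g 2 1 A).card + (cls g 2 1 B).card ≤ (cls g 2 0 A).card + (cls g 2 0 B).card ∧
      (cls g 4 2 A).card + (cls g 4 2 B).card ≤ (cls g 4 0 A).card + (cls g 4 0 B).card := by
    rcases le_total ((cls g 4 2 A).card + (cls g 4 2 B).card)
      ((cls g 4 0 A).card + (cls g 4 0 B).card) with h | h
    · exact ⟨g, hg, hgpos, hgmin, h⟩
    · have s1 : ∀ D : Finset ℝ, cls (fun t => g t + 2) 2 1 D = cls g 2 1 D := by
        intro D; ext a; simp only [mem_cls]; constructor <;> rintro ⟨p, q⟩ <;> exact ⟨p, by omega⟩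
      have s2 : ∀ D : Finset ℝ, cls (fun t => g t + 2) 2 0 D = cls g 2 0 D := by
        intro D; ext a; simp only [mem_cls]; constructor <;> rintro ⟨p, q⟩ <;> exact ⟨p, by omega⟩
      have s3 : ∀ D : Finset ℝ, cls (fun t => g t + 2) 4 0 D = cls g 4 2 D := by
        intro D; ext a; simp only [mem_cls]; constructor <;> rintro ⟨p, q⟩ <;> exact ⟨p, by omega⟩
      have s4 : ∀ D : Finset ℝ, cls (fun t => g t + 2) 4 2 D = cls g 4 0 D := by
        intro D; ext a; simp only [mem_cls]; constructor <;> rintro ⟨p, q⟩ <;> exact ⟨p, by omega⟩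
      refine ⟨fun t => g t + 2, ?_, ?_, ?_, ?_⟩
      · intro a ha b hb c hc habc
        have := hg a ha b hb c hc habc
        simp only
        omega
      · rw [s1, s1]
        exact hgpos
      · rw [s1, s1, s2, s2]
        exact hgmin
      · rw [s3, s3, s4, s4]
        exact h
  have e1 := card_cls_two k A
  have e2 := card_cls_two k B
  exact step A B k hk hkpos hkmin hkuv (ih _ (by omega) _ _ rfl)

/-- If `A` and `B` are finite sets of real numbers, then the number of triples
`(a,b,c)` with `a ∈ A`, `b ∈ B`, `c ∈ A ∪ B`, and `a + b = 2c`, is at most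
`0.15(|A|+|B|)² + 0.5(|A|+|B|)`. -/
theorem stmt0 (A B : Finset ℝ) :
    (((A ×ˢ B ×ˢ (A ∪ B)).filter (fun p => p.1 + p.2.1 = 2 * p.2.2)).card : ℝ) ≤
      0.15 * ((A.card : ℝ) + B.card) ^ 2 + 0.5 * ((A.card : ℝ) + B.card) := by
  refine le_trans ?_ (main_bound _ A B rfl)
  rw [Nat.cast_le]
  apply Finset.card_le_card_of_injOn (fun p => (p.1, p.2.1))
  · rintro ⟨a, b, c⟩ hp
    have hp' := Finset.mem_filter.1 hp
    simp only [Finset.mem_product] at hp'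
    refine mem_midPairs.2 ⟨⟨hp'.1.1, hp'.1.2.1⟩, ?_⟩
    have : (a + b) / 2 = c := by linarith [hp'.2]
    simp only
    rw [this]
    exact hp'.1.2.2
  · rintro ⟨a, b, c⟩ hp ⟨a', b', c'⟩ hq h
    have hp' := (Finset.mem_filter.1 hp).2
    have hq' := (Finset.mem_filter.1 hq).2
    simp only [Prod.mk.injEq] at h hp' hq' ⊢
    refine ⟨h.1, h.2, ?_⟩
    linarith [h.1, h.2]
end

section
/- If $A$ is a finite antisymmetric set of real numbers, then the number of triples $(a,b,c)$ with $a, b, c \in A$ and $a - b = 2c$ is at most $0.3|A|^2 + 0.5|A|$. -/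
open Pointwise

/-- per-grid bound, uniform form -/
lemma grid_uniform (p q K G : ℝ) 
    (h1 : G ≤ K * p) (h2 : G ≤ K * q) (h3 : G ≤ p * q)
    (h4 : |p - q| ≤ K → K ≤ p + q → 4 * G ≤ 2 * K * (p + q) - K ^ 2 - (p - q) ^ 2 + 1) :
    (|p - q| ≤ K ∧ K ≤ p + q ∧ 4 * G ≤ 2 * K * (p + q) - K ^ 2 - (p - q) ^ 2 + 1) ∨
    (K < |p - q| ∧ 4 * G ≤ 2 * K * (p + q) - 2 * K * |p - q|) ∨
    (p + q < K ∧ 4 * G ≤ (p + q) ^ 2 - (p - q) ^ 2) := by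
  by_cases a : |p - q| ≤ K
  · by_cases b : K ≤ p + q
    · exact Or.inl ⟨a, b, h4 a b⟩
    · right; right; exact ⟨by linarith, by nlinarith⟩
  · right; left
    refine ⟨by linarith, ?_⟩
    rcases abs_cases (p - q) with ⟨h, _⟩ | ⟨h, _⟩ <;> rw [h] <;> nlinarith

lemma arith_big (p q p' q' K Y G G' : ℝ) (hp : 0 ≤ p) (hq : 0 ≤ q) (hp' : 0 ≤ p') (hq' : 0 ≤ q')
    (hK : 1 ≤ K) (hd : K < p - q) (hd' : K < p' - q')
    (hG : G ≤ K * q) (hG' : G' ≤ K * q')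
    (hY1 : Y ≤ 0.15 * (p + q + p' + q') ^ 2 + 0.5 * (p + q + p' + q'))
    (hY2 : Y ≤ p * p' + q * q') :
    K ^ 2 / 4 + Y + G + G' ≤ 0.15 * (p + q + p' + q' + K) ^ 2 + 0.5 * (p + q + p' + q' + K) := by
  obtain ⟨E, hE⟩ : ∃ E, E = p + q + p' + q' := ⟨_, rfl⟩
  obtain ⟨y, hy⟩ : ∃ y, y = q + q' := ⟨_, rfl⟩
  have hY3 : Y ≤ ((E - y) ^ 2 + y ^ 2) / 4 := by
    subst hE hy; nlinarith [sq_nonneg (p - p'), sq_nonneg (q - q')]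
  have hX : G + G' ≤ K * y := by subst hy; nlinarith
  have hyE : y ≤ E / 2 - K := by linarith
  have hy0 : 0 ≤ y := by linarith
  rw [← hE] at hY1 ⊢
  by_cases c : y ≤ 0.3 * E - 0.1 * K
  · nlinarith
  · have c' : 0.3 * E - 0.1 * K < y := by linarith
    have h1 : 0 ≤ (y - (0.3 * E - 0.1 * K)) * (E / 2 - K - y) :=
      mul_nonneg (by linarith) (by linarith)
    have hE45 : 4.5 * K ≤ E := by linarith
    -- y^2 / 2 + y (K - E/2) - .3 E K + .1 K^2 + .1 E^2 ≤ 0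
    have h2 : 0 ≤ (E - 4.5 * K) * (y - (0.3 * E - 0.1 * K)) :=
      mul_nonneg (by linarith) (by linarith)
    have h3 : 0 ≤ (E - 4.5 * K) * E := mul_nonneg (by linarith) (by linarith)
    have h4 : 0 ≤ (E - 4.5 * K) * K := mul_nonneg (by linarith) (by linarith)
    have h5 : y ^ 2 / 2 + y * (K - E / 2) - 0.3 * E * K + 0.1 * K ^ 2 + 0.1 * E ^ 2 ≤ 0 := by
      nlinarith [sq_nonneg K]
    linarith

lemma arith_fin (E K Z : ℝ) (hE : 0 ≤ E) (hK : 1 ≤ K)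
   (h : Z ≤ E ^ 2 / 8 + K * E / 2 - K ^ 2 / 2 + 1 / 2) :
    K ^ 2 / 4 + Z ≤ 0.15 * (E + K) ^ 2 + 0.5 * (E + K) := by
  nlinarith [sq_nonneg (E - 4 * K)]

lemma arith_main (p q p' q' K Y G G' : ℝ) (hp : 0 ≤ p) (hq : 0 ≤ q) (hp' : 0 ≤ p') (hq' : 0 ≤ q')
    (hK : 1 ≤ K) (hKE : K ≤ p + q + p' + q')
    (h1 : G ≤ K * p) (h2 : G ≤ K * q) (h3 : G ≤ p * q)
    (h4 : |p - q| ≤ K → K ≤ p + q → 4 * G ≤ 2 * K * (p + q) - K ^ 2 - (p - q) ^ 2 + 1)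
    (h1' : G' ≤ K * p') (h2' : G' ≤ K * q') (h3' : G' ≤ p' * q')
    (h4' : |p' - q'| ≤ K → K ≤ p' + q' →
      4 * G' ≤ 2 * K * (p' + q') - K ^ 2 - (p' - q') ^ 2 + 1)
    (hY1 : Y ≤ 0.15 * (p + q + p' + q') ^ 2 + 0.5 * (p + q + p' + q'))
    (hY2 : Y ≤ p * p' + q * q') :
    K ^ 2 / 4 + Y + G + G' ≤ 0.15 * (p + q + p' + q' + K) ^ 2 + 0.5 * (p + q + p' + q' + K) := by
  by_cases hE2 : p + q + p' + q' ≤ 2 * K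
  · have : Y + G + G' ≤ (p + q + p' + q') ^ 2 / 4 := by
      nlinarith [sq_nonneg (p + q' - p' - q)]
    nlinarith [mul_nonneg (by linarith : 0 ≤ p + q + p' + q' - K)
      (by linarith : 0 ≤ 2 * K - (p + q + p' + q'))]
  replace hE2 : 2 * K < p + q + p' + q' := by linarith
  by_cases b1 : K < p - q ∧ K < p' - q'
  · exact arith_big p q p' q' K Y G G' hp hq hp' hq' hK b1.1 b1.2 h2 h2' hY1 hY2
  by_cases b2 : K < q - p ∧ K < q' - p'
  · have := arith_big q p q' p' K Y G G' hq hp hq' hp' hK b2.1 b2.2 h1 h1' (by linarith) (by linarith)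
    linarith
  suffices hs : Y + G + G' ≤ (p + q + p' + q') ^ 2 / 8 + K * (p + q + p' + q') / 2 - K ^ 2 / 2
      + 1 / 2 by
    have := arith_fin _ K _ (by linarith) hK hs
    linarith
  obtain ⟨s, hs⟩ : ∃ s, s = p + q := ⟨_, rfl⟩
  obtain ⟨t, ht⟩ : ∃ s, s = p' + q' := ⟨_, rfl⟩
  obtain ⟨d, hd⟩ : ∃ s, s = p - q := ⟨_, rfl⟩
  obtain ⟨e, he⟩ : ∃ s, s = p' - q' := ⟨_, rfl⟩
  have hY : Y ≤ (s * t + d * e) / 2 := by subst hs ht hd he; linarith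
  have u := grid_uniform p q K G h1 h2 h3 h4
  have v := grid_uniform p' q' K G' h1' h2' h3' h4'
  have hds : |d| ≤ s := by rw [abs_le]; constructor <;> linarith
  have het : |e| ≤ t := by rw [abs_le]; constructor <;> linarith
  have hE : p + q + p' + q' = s + t := by linarith
  have n1 : ¬ (K < d ∧ K < e) := by rw [hd, he]; exact b1
  have n2 : ¬ (K < -d ∧ K < -e) := by rw [hd, he]; intro h; apply b2; constructor <;> linarith
  rw [hE] at hE2 ⊢
  rw [← hs, ← hd] at u
  rw [← ht, ← he] at v
  clear h1 h2 h3 h4 h1' h2' h3' h4' hY1 hY2 b1 b2 hE hs ht hd he hKE hp hq hp' hq'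
  clear p q p' q'
  have st := sq_nonneg (s - t)
  have de := sq_nonneg (d - e)
  rcases u with ⟨u1, u2, u3⟩ | ⟨u1, u2⟩ | ⟨u1, u2⟩ <;>
  rcases v with ⟨v1, v2, v3⟩ | ⟨v1, v2⟩ | ⟨v1, v2⟩
  · nlinarith
  · -- |e| > K, |d| ≤ K
    rw [abs_le] at u1
    rcases abs_cases e with ⟨h, _⟩ | ⟨h, _⟩ <;> rw [h] at v1 v2
    · nlinarith [mul_nonneg (by linarith : 0 ≤ K - d) (by linarith : 0 ≤ e - K)]
    · nlinarith [mul_nonneg (by linarith : 0 ≤ K + d) (by linarith : 0 ≤ -e - K)]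
  · nlinarith [mul_nonneg (by linarith : 0 ≤ s - t) (by linarith : 0 ≤ K - t),
      mul_nonneg (by linarith : 0 ≤ s + t - 2 * K) (by linarith : 0 ≤ K - t)]
  · rw [abs_le] at v1
    rcases abs_cases d with ⟨h, _⟩ | ⟨h, _⟩ <;> rw [h] at u1 u2
    · nlinarith [mul_nonneg (by linarith : 0 ≤ K - e) (by linarith : 0 ≤ d - K)]
    · nlinarith [mul_nonneg (by linarith : 0 ≤ K + e) (by linarith : 0 ≤ -d - K)]
  · rcases abs_cases d with ⟨h, _⟩ | ⟨h, _⟩ <;> rw [h] at u1 u2 <;>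
    rcases abs_cases e with ⟨h, _⟩ | ⟨h, _⟩ <;> rw [h] at v1 v2
    · exact absurd ⟨u1, v1⟩ n1
    · nlinarith [mul_pos (by linarith : 0 < d) (by linarith : 0 < -e)]
    · nlinarith [mul_pos (by linarith : 0 < -d) (by linarith : 0 < e)]
    · exact absurd ⟨u1, v1⟩ n2
  · -- |d| > K, t < K
    have het' := abs_le.1 het
    have w : 0 ≤ (s + t - 2 * K) * (K - t) := mul_nonneg (by linarith) (by linarith)
    rcases abs_cases d with ⟨h, _⟩ | ⟨h, _⟩ <;> rw [h] at u1 u2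
    · nlinarith [mul_nonneg (by linarith : 0 ≤ K - e) (by linarith : 0 ≤ d - K)]
    · nlinarith [mul_nonneg (by linarith : 0 ≤ K + e) (by linarith : 0 ≤ -d - K)]
  · nlinarith [mul_nonneg (by linarith : 0 ≤ t - s) (by linarith : 0 ≤ K - s),
      mul_nonneg (by linarith : 0 ≤ s + t - 2 * K) (by linarith : 0 ≤ K - s)]
  · have het' := abs_le.1 hds
    have w : 0 ≤ (s + t - 2 * K) * (K - s) := mul_nonneg (by linarith) (by linarith)
    rcases abs_cases e with ⟨h, _⟩ | ⟨h, _⟩ <;> rw [h] at v1 v2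
    · nlinarith [mul_nonneg (by linarith : 0 ≤ K - d) (by linarith : 0 ≤ e - K)]
    · nlinarith [mul_nonneg (by linarith : 0 ≤ K + d) (by linarith : 0 ≤ -e - K)]
  · linarith

lemma parity_map (C : Finset ℝ) (x y : ℝ) (hx : x ∈ C) (hy : y ∈ C) (hxy : x ≠ y) :
    ∃ h : ℝ → ℤ, (∀ a ∈ C, ∀ b ∈ C, ∀ c ∈ C, a + b = 2 * c → h a + h b = 2 * h c) ∧
      (∃ a ∈ C, h a % 2 = 0) ∧ (∃ a ∈ C, h a % 2 = 1) := by
  obtain ⟨f, hf⟩ : ∃ f : Module.Dual ℚ ℝ, f (x - y) ≠ 0 := by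
    by_contra hcon
    push Not at hcon
    exact hxy (sub_eq_zero.1 ((Module.forall_dual_apply_eq_zero_iff ℚ (x - y)).1 hcon))
  let D : ℕ := ∏ c ∈ C, (f c).den
  have hD : (D : ℚ) ≠ 0 := by
    have : D ≠ 0 := Finset.prod_ne_zero_iff.2 fun c _ => (f c).den_nz
    exact_mod_cast this
  have hint : ∀ c ∈ C, ∃ z : ℤ, (z : ℚ) = D * f c := by
    intro c hc
    obtain ⟨k, hk⟩ := Finset.dvd_prod_of_mem (fun c => (f c).den) hc
    refine ⟨k * (f c).num, ?_⟩
    have hk' : (D : ℚ) = (f c).den * k := by exact_mod_cast hk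
    rw [hk']
    push_cast
    have := Rat.den_mul_eq_num (f c)
    rw [← this]; ring
  choose! u hu using hint
  let w : ℝ → ℤ := fun c => u c - u x
  have hw : ∀ a ∈ C, ∀ b ∈ C, ∀ c ∈ C, a + b = 2 * c → w a + w b = 2 * w c := by
    intro a ha b hb c hc habc
    have h1 : f a + f b = 2 * f c := by
      rw [← map_add, habc, two_mul, map_add, two_mul]
    have : (u a : ℚ) + u b = 2 * u c := by
      rw [hu a ha, hu b hb, hu c hc]; linear_combination (D : ℚ) * h1
    have : u a + u b = 2 * u c := by exact_mod_cast this
    simp only [w]; linarith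
  have hwy : w y ≠ 0 := by
    intro h0
    have h1 : u y = u x := by simp only [w] at h0; linarith
    have h2 : (u y : ℚ) = u x := by exact_mod_cast h1
    rw [hu y hy, hu x hx] at h2
    have := mul_left_cancel₀ hD h2
    rw [map_sub] at hf
    exact hf (by rw [this]; ring)
  let g := C.gcd w
  have hg0 : g ≠ 0 := fun h => hwy (Finset.gcd_eq_zero_iff.1 h y hy)
  have hg : ∀ c ∈ C, w c = g * (w c / g) := fun c hc => (Int.mul_ediv_cancel' (Finset.gcd_dvd hc)).symm
  refine ⟨fun c => w c / g, ?_, ⟨x, hx, by simp [w]⟩, ?_⟩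
  · intro a ha b hb c hc habc
    have := hw a ha b hb c hc habc
    rw [hg a ha, hg b hb, hg c hc] at this
    apply mul_left_cancel₀ hg0
    linarith
  · by_contra hcon
    push Not at hcon
    have h1 : C.gcd (fun c => w c / g) = 1 := Finset.gcd_div_eq_one hy hwy
    have h2 : (2 : ℤ) ∣ C.gcd (fun c => w c / g) := by
      apply Finset.dvd_gcd
      intro c hc
      have := hcon c hc
      omega
    rw [h1] at h2
    norm_num at h2

/-- pairs with sum in `S` -/
lemma grid_le_mul (P Q S : Finset ℝ) :
    ((P ×ˢ Q).filter (fun z => z.1 + z.2 ∈ S)).card ≤ S.card * P.card := by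
  rw [mul_comm, ← Finset.card_product]
  apply Finset.card_le_card_of_injOn (fun z => (z.1, z.1 + z.2))
  · intro z hz
    simp only [Finset.coe_filter, Finset.mem_product, Set.mem_ofPred_eq, Finset.coe_product, Set.mem_prod, Finset.mem_coe] at hz ⊢
    exact ⟨hz.1.1, hz.2⟩
  · rintro ⟨a, b⟩ _ ⟨c, d⟩ _ h
    simp only [Prod.mk.injEq] at h ⊢
    exact ⟨h.1, by linarith [h.1, h.2]⟩

lemma grid_le_mul' (P Q S : Finset ℝ) :
    ((P ×ˢ Q).filter (fun z => z.1 + z.2 ∈ S)).card ≤ S.card * Q.card := by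
  rw [mul_comm, ← Finset.card_product]
  apply Finset.card_le_card_of_injOn (fun z => (z.2, z.1 + z.2))
  · intro z hz
    simp only [Finset.coe_filter, Finset.mem_product, Set.mem_ofPred_eq, Finset.coe_product, Set.mem_prod, Finset.mem_coe] at hz ⊢
    exact ⟨hz.1.2, hz.2⟩
  · rintro ⟨a, b⟩ _ ⟨c, d⟩ _ h
    simp only [Prod.mk.injEq] at h ⊢
    exact ⟨by linarith [h.1, h.2], h.1⟩

lemma grid_le_prod (P Q S : Finset ℝ) :
    ((P ×ˢ Q).filter (fun z => z.1 + z.2 ∈ S)).card ≤ P.card * Q.card := by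
  rw [← Finset.card_product]; exact Finset.card_filter_le _ _

lemma grid_step (P Q S : Finset ℝ) (hP : P.Nonempty) (hQ : Q.Nonempty) :
    ((P ×ˢ Q).filter (fun z => z.1 + z.2 ∈ S)).card ≤ S.card +
     (((P.erase (P.min' hP)) ×ˢ (Q.erase (Q.max' hQ))).filter (fun z => z.1 + z.2 ∈ S)).card := by
  set a := P.min' hP with ha
  set b := Q.max' hQ with hb
  have hsub : (P ×ˢ Q).filter (fun z => z.1 + z.2 ∈ S) ⊆
     ((P ×ˢ Q).filter (fun z => z.1 + z.2 ∈ S ∧ (z.1 = a ∨ z.2 = b))) ∪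
     ((P.erase a) ×ˢ (Q.erase b)).filter (fun z => z.1 + z.2 ∈ S) := by
    intro z hz
    simp only [Finset.mem_union, Finset.mem_filter, Finset.mem_product, Finset.mem_erase] at hz ⊢
    tauto
  refine (Finset.card_le_card hsub).trans ((Finset.card_union_le _ _).trans ?_)
  gcongr
  apply Finset.card_le_card_of_injOn (fun z => z.1 + z.2)
  · intro z hz
    simp only [Finset.coe_filter, Finset.mem_product, Set.mem_ofPred_eq, Finset.mem_coe] at hz ⊢
    exact hz.2.1
  · rintro ⟨x, y⟩ h1 ⟨x', y'⟩ h2 h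
    simp only [Finset.coe_filter, Finset.mem_product, Set.mem_ofPred_eq] at h1 h2 h
    have e1 := Finset.min'_le P x h1.1.1
    have e2 := Finset.min'_le P x' h2.1.1
    have e3 := Finset.le_max' Q y h1.1.2
    have e4 := Finset.le_max' Q y' h2.1.2
    rw [← ha] at e1 e2
    rw [← hb] at e3 e4
    simp only [Prod.mk.injEq]
    rcases h1.2.2 with r | r <;> rcases h2.2.2 with r' | r' <;> constructor <;> linarith

lemma grid_main (K : ℕ) (n : ℕ) : ∀ (P Q S : Finset ℝ), P.card = n → S.card ≤ K →
    |(P.card : ℝ) - Q.card| ≤ K → (K : ℝ) ≤ P.card + Q.card →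
    4 * (((P ×ˢ Q).filter (fun z => z.1 + z.2 ∈ S)).card : ℝ) ≤
      2 * K * (P.card + Q.card) - (K : ℝ) ^ 2 - ((P.card : ℝ) - Q.card) ^ 2 + 1 := by
  induction n with
  | zero =>
    intro P Q S hP hS hd hs
    have : P = ∅ := Finset.card_eq_zero.1 hP
    subst this
    simp at hd hs ⊢
    have : (K : ℝ) = Q.card := by exact_mod_cast le_antisymm hs hd
    rw [this]; nlinarith
  | succ n ih =>
    intro P Q S hP hS hd hs
    by_cases hK : P.card + Q.card ≤ K + 1
    · have h1 : (((P ×ˢ Q).filter (fun z => z.1 + z.2 ∈ S)).card : ℝ) ≤ P.card * Q.card := by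
        exact_mod_cast grid_le_prod P Q S
      have h2 : (P.card : ℝ) + Q.card ≤ K + 1 := by exact_mod_cast hK
      nlinarith
    · have hPn : P.Nonempty := by rw [← Finset.card_pos]; omega
      have hK' : K + 2 ≤ P.card + Q.card := by omega
      have hK2 : (K : ℝ) + 2 ≤ P.card + Q.card := by exact_mod_cast hK'
      have hQn : Q.Nonempty := by
        rw [← Finset.card_pos]
        by_contra hq
        have : Q.card = 0 := by omega
        rw [this] at hK2 hd
        have := (abs_le.1 hd).2
        push_cast at this hK2
        linarith
      have hst := grid_step P Q S hPn hQn
      have hp := Finset.card_erase_add_one (P.min'_mem hPn)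
      have hq := Finset.card_erase_add_one (Q.max'_mem hQn)
      have := ih (P.erase (P.min' hPn)) (Q.erase (Q.max' hQn)) S (by omega) hS
      set G := ((P ×ˢ Q).filter (fun z => z.1 + z.2 ∈ S)).card
      set G' := (((P.erase (P.min' hPn)) ×ˢ (Q.erase (Q.max' hQn))).filter (fun z => z.1 + z.2 ∈ S)).card
      have hp' : (P.card : ℝ) = ((P.erase (P.min' hPn)).card : ℝ) + 1 := by exact_mod_cast hp.symm
      have hq' : (Q.card : ℝ) = ((Q.erase (Q.max' hQn)).card : ℝ) + 1 := by exact_mod_cast hq.symm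
      have hG : (G : ℝ) ≤ K + G' := by exact_mod_cast hst.trans (by omega)
      rw [hp', hq'] at hd hK2 ⊢
      have := this (by convert hd using 2; ring) (by linarith)
      nlinarith


open Classical in
lemma swap_parity (C : Finset ℝ) (x y : ℝ) (hx : x ∈ C) (hy : y ∈ C) (hxy : x ≠ y)
    (F : (ℝ → ℤ) → ℤ → ℕ) (hF : ∀ h, F (fun z => h z + 1) 0 = F h 1)
    (hF' : ∀ h, F (fun z => h z + 1) 1 = F h 0) :
    ∃ h : ℝ → ℤ, (∀ a ∈ C, ∀ b ∈ C, ∀ c ∈ C, a + b = 2 * c → h a + h b = 2 * h c) ∧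
      (∃ a ∈ C, h a % 2 = 1) ∧ F h 1 ≤ F h 0 := by
  obtain ⟨h, h1, ⟨a, ha, ha'⟩, h3⟩ := parity_map C x y hx hy hxy
  by_cases hc : F h 1 ≤ F h 0
  · exact ⟨h, h1, h3, hc⟩
  · refine ⟨fun z => h z + 1, ?_, ⟨a, ha, by show (h a + 1) % 2 = 1; omega⟩, ?_⟩
    · intro a ha b hb c hc habc
      have := h1 a ha b hb c hc habc
      linarith
    · rw [hF, hF']; omega

lemma bichromatic (n : ℕ) : ∀ A B : Finset ℝ, A.card + B.card = n →
    (((A ×ˢ B).filter (fun z => (z.1 + z.2) / 2 ∈ A ∪ B)).card : ℝ) ≤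
      0.15 * ((A.card : ℝ) + B.card) ^ 2 + 0.5 * ((A.card : ℝ) + B.card) := by
  induction n using Nat.strong_induction_on with
  | _ n ih =>
  intro A B hn
  by_cases hsub : ∃ x ∈ A ∪ B, ∃ y ∈ A ∪ B, x ≠ y
  swap
  · push Not at hsub
    have hA : A.card ≤ 1 := Finset.card_le_one.2 fun a ha b hb =>
      hsub a (Finset.mem_union_left _ ha) b (Finset.mem_union_left _ hb)
    have hB : B.card ≤ 1 := Finset.card_le_one.2 fun a ha b hb =>
      hsub a (Finset.mem_union_right _ ha) b (Finset.mem_union_right _ hb)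
    have h1 : ((A ×ˢ B).filter (fun z => (z.1 + z.2) / 2 ∈ A ∪ B)).card ≤ A.card * B.card := by
      rw [← Finset.card_product]; exact Finset.card_filter_le _ _
    have h2 : (((A ×ˢ B).filter (fun z => (z.1 + z.2) / 2 ∈ A ∪ B)).card : ℝ)
      ≤ A.card * B.card := by exact_mod_cast h1
    refine h2.trans ?_
    interval_cases A.card <;> interval_cases B.card <;> norm_num
  obtain ⟨x, hx, y, hy, hxy⟩ := hsub
  obtain ⟨h, hlin, ⟨w, hw, hw1⟩, hle⟩ := swap_parity (A ∪ B) x y hx hy hxy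
    (fun h r => (A.filter (fun z => h z % 2 = r)).card + (B.filter (fun z => h z % 2 = r)).card)
    (by
      intro h
      have : ∀ z : ℝ, ((h z + 1) % 2 = 0) = (h z % 2 = 1) := by intro z; apply propext; omega
      simp only [this])
    (by
      intro h
      have : ∀ z : ℝ, ((h z + 1) % 2 = 1) = (h z % 2 = 0) := by intro z; apply propext; omega
      simp only [this])
  set A0 := A.filter (fun z => h z % 4 = 0) with hA0
  set A2 := A.filter (fun z => h z % 4 = 2) with hA2
  set B0 := B.filter (fun z => h z % 4 = 0) with hB0
  set B2 := B.filter (fun z => h z % 4 = 2) with hB2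
  set Ao := A.filter (fun z => h z % 2 = 1) with hAo
  set Bo := B.filter (fun z => h z % 2 = 1) with hBo
  set Ae := A.filter (fun z => h z % 2 = 0) with hAe
  set Be := B.filter (fun z => h z % 2 = 0) with hBe
  have cAe : Ae.card = A0.card + A2.card := by
    rw [← Finset.card_union_of_disjoint]
    · congr 1; ext z
      simp only [hAe, hA0, hA2, Finset.mem_union, Finset.mem_filter, ← and_or_left]
      apply and_congr_right; intro _; omega
    · rw [Finset.disjoint_filter]; intro z _; omega
  have cBe : Be.card = B0.card + B2.card := by
    rw [← Finset.card_union_of_disjoint]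
    · congr 1; ext z
      simp only [hBe, hB0, hB2, Finset.mem_union, Finset.mem_filter, ← and_or_left]
      apply and_congr_right; intro _; omega
    · rw [Finset.disjoint_filter]; intro z _; omega
  have cA : A.card = Ae.card + Ao.card := by
    rw [← Finset.card_union_of_disjoint]
    · congr 1; ext z
      simp only [hAe, hAo, Finset.mem_union, Finset.mem_filter, ← and_or_left]
      have : h z % 2 = 0 ∨ h z % 2 = 1 := by omega
      tauto
    · rw [Finset.disjoint_filter]; intro z _; omega
  have cB : B.card = Be.card + Bo.card := by
    rw [← Finset.card_union_of_disjoint]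
    · congr 1; ext z
      simp only [hBe, hBo, Finset.mem_union, Finset.mem_filter, ← and_or_left]
      have : h z % 2 = 0 ∨ h z % 2 = 1 := by omega
      tauto
    · rw [Finset.disjoint_filter]; intro z _; omega
  obtain ⟨K, hK⟩ : ∃ K, K = Ao.card + Bo.card := ⟨_, rfl⟩
  have hK1 : 1 ≤ K := by
    rcases Finset.mem_union.1 hw with hw | hw
    · have : 0 < Ao.card := Finset.card_pos.2 ⟨w, Finset.mem_filter.2 ⟨hw, hw1⟩⟩
      omega
    · have : 0 < Bo.card := Finset.card_pos.2 ⟨w, Finset.mem_filter.2 ⟨hw, hw1⟩⟩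
      omega
  obtain ⟨S, hS⟩ : ∃ S, S = (Ao ∪ Bo).image (fun z => 2 * z) := ⟨_, rfl⟩
  have cS : S.card ≤ K := by
    rw [hS, hK]; exact Finset.card_image_le.trans (Finset.card_union_le _ _)
  -- the even-even part
  set Y := (Ae ×ˢ Be).filter (fun z => (z.1 + z.2) / 2 ∈ Ae ∪ Be) with hY
  have hY1 := ih (Ae.card + Be.card) (by omega) Ae Be rfl
  rw [← hY] at hY1
  have hmid : ∀ a ∈ A, ∀ b ∈ B, (a + b) / 2 ∈ A ∪ B → h a + h b = 2 * h ((a + b) / 2) := by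
    intro a ha b hb hc
    exact hlin a (Finset.mem_union_left _ ha) b (Finset.mem_union_right _ hb) _ hc (by ring)
  have hY2 : Y.card ≤ A0.card * B0.card + B2.card * A2.card := by
    rw [mul_comm B2.card, ← Finset.card_product, ← Finset.card_product]
    refine (Finset.card_le_card ?_).trans (Finset.card_union_le _ _)
    rintro ⟨a, b⟩ hz
    simp only [hY, hAe, hBe, hA0, hA2, hB0, hB2, Finset.mem_union, Finset.mem_filter,
      Finset.mem_product] at hz ⊢
    obtain ⟨⟨⟨ha, ha'⟩, hb, hb'⟩, hc⟩ := hz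
    have hc1 : (a + b) / 2 ∈ A ∪ B := by rw [Finset.mem_union]; tauto
    have hc2 : h ((a + b) / 2) % 2 = 0 := by tauto
    have := hmid a ha b hb hc1
    have h3 : (h a % 4 = 0 ∧ h b % 4 = 0) ∨ (h a % 4 = 2 ∧ h b % 4 = 2) := by omega
    tauto
  set G := (A0 ×ˢ B2).filter (fun z => z.1 + z.2 ∈ S) with hG
  set G' := (B0 ×ˢ A2).filter (fun z => z.1 + z.2 ∈ S) with hG'
  have hT : ((A ×ˢ B).filter (fun z => (z.1 + z.2) / 2 ∈ A ∪ B)).card ≤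
      Ao.card * Bo.card + Y.card + G.card + G'.card := by
    have e : G'.card = (G'.image Prod.swap).card :=
      (Finset.card_image_of_injective _ Prod.swap_injective).symm
    rw [e, ← Finset.card_product]
    have hsub : (A ×ˢ B).filter (fun z => (z.1 + z.2) / 2 ∈ A ∪ B) ⊆
        (((Ao ×ˢ Bo) ∪ Y) ∪ G) ∪ G'.image Prod.swap := by
      rintro ⟨a, b⟩ hz
      rw [Finset.mem_filter, Finset.mem_product] at hz
      obtain ⟨⟨ha, hb⟩, hc⟩ := hz
      simp only at ha hb hc
      have hm := hmid a ha b hb hc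
      rw [Finset.mem_union, Finset.mem_union, Finset.mem_union]
      by_cases o : h a % 2 = 1
      · left; left; left
        exact Finset.mem_product.2 ⟨Finset.mem_filter.2 ⟨ha, o⟩,
          Finset.mem_filter.2 ⟨hb, by simp only; omega⟩⟩
      have ea : h a % 2 = 0 := by omega
      have eb : h b % 2 = 0 := by omega
      by_cases c : h ((a + b) / 2) % 2 = 0
      · left; left; right
        refine Finset.mem_filter.2 ⟨Finset.mem_product.2 ⟨Finset.mem_filter.2 ⟨ha, ea⟩,
          Finset.mem_filter.2 ⟨hb, eb⟩⟩, ?_⟩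
        rw [Finset.mem_union] at hc ⊢
        rw [hAe, hBe, Finset.mem_filter, Finset.mem_filter]
        tauto
      · have c1 : h ((a + b) / 2) % 2 = 1 := by omega
        have hs : a + b ∈ S := by
          rw [hS, Finset.mem_image]
          refine ⟨(a + b) / 2, ?_, by ring⟩
          rw [Finset.mem_union] at hc ⊢
          rw [hAo, hBo, Finset.mem_filter, Finset.mem_filter]
          tauto
        by_cases a0 : h a % 4 = 0
        · left; right
          exact Finset.mem_filter.2 ⟨Finset.mem_product.2 ⟨Finset.mem_filter.2 ⟨ha, a0⟩,
            Finset.mem_filter.2 ⟨hb, by simp only; omega⟩⟩, hs⟩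
        · right
          refine Finset.mem_image.2 ⟨(b, a), ?_, rfl⟩
          exact Finset.mem_filter.2 ⟨Finset.mem_product.2
            ⟨Finset.mem_filter.2 ⟨hb, by simp only; omega⟩,
            Finset.mem_filter.2 ⟨ha, by simp only; omega⟩⟩, by simp only; rw [add_comm]; exact hs⟩
    refine (Finset.card_le_card hsub).trans ?_
    refine (Finset.card_union_le _ _).trans ?_
    gcongr
    refine (Finset.card_union_le _ _).trans ?_
    gcongr
    exact Finset.card_union_le _ _
  have g1 : G.card ≤ K * A0.card := (grid_le_mul A0 B2 S).trans (Nat.mul_le_mul_right _ cS)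
  have g2 : G.card ≤ K * B2.card := (grid_le_mul' A0 B2 S).trans (Nat.mul_le_mul_right _ cS)
  have g3 : G.card ≤ A0.card * B2.card := grid_le_prod A0 B2 S
  have g4 := grid_main K _ A0 B2 S rfl cS
  have g1' : G'.card ≤ K * B0.card := (grid_le_mul B0 A2 S).trans (Nat.mul_le_mul_right _ cS)
  have g2' : G'.card ≤ K * A2.card := (grid_le_mul' B0 A2 S).trans (Nat.mul_le_mul_right _ cS)
  have g3' : G'.card ≤ B0.card * A2.card := grid_le_prod B0 A2 S
  have g4' := grid_main K _ B0 A2 S rfl cS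
  rw [← hG] at g4
  rw [← hG'] at g4'
  have hKE : K ≤ A0.card + B2.card + B0.card + A2.card := by omega
  have cAr : (A.card : ℝ) + B.card = A0.card + B2.card + B0.card + A2.card + K := by
    have : A.card + B.card = A0.card + B2.card + B0.card + A2.card + K := by omega
    exact_mod_cast this
  have cEr : (Ae.card : ℝ) + Be.card = A0.card + B2.card + B0.card + A2.card := by
    have : Ae.card + Be.card = A0.card + B2.card + B0.card + A2.card := by omega
    exact_mod_cast this
  rw [cEr] at hY1
  have key := arith_main A0.card B2.card B0.card A2.card K Y.card G.card G'.card
    (by positivity) (by positivity) (by positivity) (by positivity)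
    (by exact_mod_cast hK1) (by exact_mod_cast hKE)
    (by exact_mod_cast g1) (by exact_mod_cast g2) (by exact_mod_cast g3) g4
    (by exact_mod_cast g1') (by exact_mod_cast g2') (by exact_mod_cast g3') g4'
    hY1 (by exact_mod_cast hY2)
  rw [cAr]
  have hTr : (((A ×ˢ B).filter (fun z => (z.1 + z.2) / 2 ∈ A ∪ B)).card : ℝ) ≤
      Ao.card * Bo.card + Y.card + G.card + G'.card := by exact_mod_cast hT
  have hKr : (K : ℝ) = Ao.card + Bo.card := by exact_mod_cast hK
  have hO : (Ao.card : ℝ) * Bo.card ≤ (K : ℝ) ^ 2 / 4 := by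
    rw [hKr]; nlinarith [sq_nonneg ((Ao.card : ℝ) - Bo.card)]
  linarith

/-- If `A` is a finite antisymmetric set of real numbers (i.e. `A ∩ (-A) = ∅`),
then the number of triples `(a,b,c)` with `a, b, c ∈ A` and `a - b = 2c`
is at most `0.3|A|² + 0.5|A|`. -/
theorem stmt1 (A : Finset ℝ) (hA : A ∩ (-A) = ∅) :
    (((A ×ˢ A ×ˢ A).filter (fun p => p.1 - p.2.1 = 2 * p.2.2)).card : ℝ) ≤
      0.3 * (A.card : ℝ) ^ 2 + 0.5 * (A.card : ℝ) := by
  have hb := bichromatic _ A (-A) rfl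
  rw [Finset.card_neg] at hb
  set R := (A ×ˢ A ×ˢ A).filter (fun p => p.1 - p.2.1 = 2 * p.2.2) with hR
  have hdis : ∀ c : ℝ, c ∈ A → -c ∈ A → False := by
    intro c h1 h2
    have : c ∈ A ∩ (-A) := Finset.mem_inter.2 ⟨h1, Finset.mem_neg'.2 h2⟩
    rw [hA] at this
    simp at this
  have h1 : (R.image (fun p => (p.1, -p.2.1))).card = R.card := by
    apply Finset.card_image_of_injOn
    rintro ⟨a, b, c⟩ h ⟨a', b', c'⟩ h' e
    simp only [hR, Finset.coe_filter, Set.mem_ofPred_eq, Prod.mk.injEq, neg_inj] at h h' e ⊢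
    refine ⟨e.1, e.2, ?_⟩
    linarith [h.2, h'.2, e.1, e.2]
  have h2 : (R.image (fun p => (p.2.1, -p.1))).card = R.card := by
    apply Finset.card_image_of_injOn
    rintro ⟨a, b, c⟩ h ⟨a', b', c'⟩ h' e
    simp only [hR, Finset.coe_filter, Set.mem_ofPred_eq, Prod.mk.injEq, neg_inj] at h h' e ⊢
    refine ⟨e.2, e.1, ?_⟩
    linarith [h.2, h'.2, e.1, e.2]
  have h3 : Disjoint (R.image (fun p => (p.1, -p.2.1))) (R.image (fun p => (p.2.1, -p.1))) := by
    rw [Finset.disjoint_left]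
    intro z hz hz'
    obtain ⟨⟨a, b, c⟩, h, rfl⟩ := Finset.mem_image.1 hz
    obtain ⟨⟨a', b', c'⟩, h', e⟩ := Finset.mem_image.1 hz'
    simp only [hR, Finset.mem_filter, Finset.mem_product, Prod.mk.injEq, neg_inj] at h h' e
    have : c' = -c := by linarith [h.2, h'.2, e.1, e.2]
    exact hdis c h.1.2.2 (this ▸ h'.1.2.2)
  have h4 : R.image (fun p => (p.1, -p.2.1)) ∪ R.image (fun p => (p.2.1, -p.1)) ⊆
      (A ×ˢ (-A)).filter (fun z => (z.1 + z.2) / 2 ∈ A ∪ (-A)) := by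
    intro z hz
    rcases Finset.mem_union.1 hz with hz | hz
    · obtain ⟨⟨a, b, c⟩, h, rfl⟩ := Finset.mem_image.1 hz
      simp only [hR, Finset.mem_filter, Finset.mem_product, Finset.mem_union,
        Finset.mem_neg', neg_neg] at h ⊢
      refine ⟨⟨h.1.1, h.1.2.1⟩, Or.inl ?_⟩
      rw [show (a + -b) / 2 = c by linarith [h.2]]
      exact h.1.2.2
    · obtain ⟨⟨a, b, c⟩, h, rfl⟩ := Finset.mem_image.1 hz
      simp only [hR, Finset.mem_filter, Finset.mem_product, Finset.mem_union,
        Finset.mem_neg', neg_neg] at h ⊢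
      refine ⟨⟨h.1.2.1, h.1.1⟩, Or.inr ?_⟩
      rw [show -((b + -a) / 2) = c by linarith [h.2]]
      exact h.1.2.2
  have h5 := Finset.card_le_card h4
  rw [Finset.card_union_of_disjoint h3, h1, h2] at h5
  have h6 : (R.card : ℝ) + R.card ≤
    ((A ×ˢ (-A)).filter (fun z => (z.1 + z.2) / 2 ∈ A ∪ (-A))).card := by exact_mod_cast h5
  linarith
end

section
/- If $A$ is a finite set of real numbers, then the number of triples $(a,b,c)$ with $a, b, c \in A$ and $a - b = 2c$ is at most $0.5|A|^2 + 0.5|A|$. -/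
/-- If `A` is a finite set of real numbers, then the number of triples `(a,b,c)`
with `a, b, c ∈ A` and `a - b = 2c` is at most `0.5|A|² + 0.5|A|`. -/
theorem stmt2 (A : Finset ℝ) :
    (((A ×ˢ A ×ˢ A).filter (fun p => p.1 - p.2.1 = 2 * p.2.2)).card : ℝ) ≤
      0.5 * (A.card : ℝ) ^ 2 + 0.5 * (A.card : ℝ) := by
  classical
  set S := (A ×ˢ A ×ˢ A).filter (fun p => p.1 - p.2.1 = 2 * p.2.2) with hS
  set T := (A ×ˢ A).filter (fun q : ℝ × ℝ => q.1 ^ 2 < q.2 ^ 2 ∨ q.2 = -q.1) with hT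
  set T' := (A ×ˢ A).filter (fun q : ℝ × ℝ => q.2 ^ 2 < q.1 ^ 2 ∨ q.1 = -q.2) with hT'
  have h1 : S.card ≤ T.card := by
    apply Finset.card_le_card_of_injOn
      (fun p => (p.2.2, if p.2.1 * p.2.2 ≤ -(p.2.2 * p.2.2) then p.2.1 else p.1))
    · rintro ⟨a, b, c⟩ h
      simp only [hS, Finset.coe_filter, Finset.mem_product, Set.mem_setOf_eq] at h
      obtain ⟨⟨ha, hb, hc⟩, h⟩ := h
      obtain rfl : a = b + 2 * c := by linarith
      simp only [hT, Finset.coe_filter, Finset.mem_product, Set.mem_setOf_eq]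
      split_ifs with hbc
      · refine ⟨⟨hc, hb⟩, ?_⟩
        by_cases e : b = -c
        · exact Or.inr e
        · left
          have : 0 < (b + c) ^ 2 := by
            have : b + c ≠ 0 := fun h => e (by linarith)
            positivity
          nlinarith
      · refine ⟨⟨hc, ha⟩, Or.inl ?_⟩
        nlinarith [sq_nonneg (b + c)]
    · rintro ⟨a, b, c⟩ h ⟨a', b', c'⟩ h' heq
      simp only [hS, Finset.coe_filter, Finset.mem_product, Set.mem_setOf_eq] at h h'
      simp only [Prod.mk.injEq] at heq
      obtain ⟨rfl, heq⟩ := heq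
      have e1 : a = b + 2 * c := by linarith [h.2]
      have e2 : a' = b' + 2 * c := by linarith [h'.2]
      subst e1 e2
      have : b = b' := by
        split_ifs at heq with u v v
        · exact heq
        · exfalso; subst heq; nlinarith [mul_self_nonneg c]
        · exfalso; subst heq; nlinarith [mul_self_nonneg c]
        · linarith
      subst this
      rfl
  have h2 : T'.card = T.card := by
    apply Finset.card_bij (fun q _ => q.swap)
    · rintro ⟨x, y⟩ h
      simp only [hT, hT', Finset.mem_filter, Finset.mem_product, Prod.swap] at h ⊢
      tauto
    · intro p _ q _ h
      exact Prod.swap_injective h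
    · rintro ⟨x, y⟩ h
      refine ⟨(y, x), ?_, rfl⟩
      simp only [hT, hT', Finset.mem_filter, Finset.mem_product] at h ⊢
      tauto
  have h3 : (T ∪ T').card ≤ A.card * A.card := by
    rw [← Finset.card_product]
    exact Finset.card_le_card
      (Finset.union_subset (Finset.filter_subset _ _) (Finset.filter_subset _ _))
  have h4 : (T ∩ T').card ≤ A.card := by
    apply Finset.card_le_card_of_injOn Prod.fst
    · rintro ⟨x, y⟩ h
      simp only [hT, Finset.coe_inter, Set.mem_inter_iff, Finset.mem_coe, Finset.mem_filter,
        Finset.mem_product] at h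
      exact h.1.1.1
    · have key : ∀ q ∈ T ∩ T', q.2 = -q.1 := by
        rintro ⟨x, y⟩ h
        simp only [hT, hT', Finset.mem_inter, Finset.mem_filter] at h
        rcases h.1.2 with u | u
        · rcases h.2.2 with v | v
          · linarith
          · simp only at v ⊢; linarith
        · exact u
      intro p hp q hq h
      exact Prod.ext h (by rw [key p hp, key q hq, h])
  have h5 := Finset.card_union_add_card_inter T T'
  have h6 : 2 * S.card ≤ A.card * A.card + A.card := by omega
  have h7 : (2 : ℝ) * S.card ≤ A.card * A.card + A.card := by exact_mod_cast h6
  norm_num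
  nlinarith
end

section
/- If $A$, $B$, and $C$ are finite sets of real numbers with $\max\{|A|,|B|\} \le |C| \le |A| + |B|$, then the number of triples $(a,b,c) \in A \times B \times C$ satisfying $a + b = c$ does not exceed $|A||B| - \tfrac{1}{4}(|A|+|B|-|C|)^2 + \tfrac{1}{4}$. -/
theorem pair_bound (C : Finset ℝ) : ∀ (n : ℕ) (A B : Finset ℝ), A.card = n →
    A.card ≤ C.card → B.card ≤ C.card → C.card ≤ A.card + B.card →
    (((A ×ˢ B).filter (fun p => p.1 + p.2 ∈ C)).card : ℝ) ≤
      (A.card : ℝ) * B.card - ((A.card : ℝ) + B.card - C.card) ^ 2 / 4 + 1 / 4 := by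
  intro n
  induction n with
  | zero =>
    intro A B hA _ hB hC
    have h : B.card = C.card := by omega
    have hA' : A = ∅ := Finset.card_eq_zero.mp hA
    subst hA'
    simp [h]
  | succ n ih =>
    intro A B hn hA hB hC
    by_cases hm : A.card + B.card ≤ C.card + 1
    · have h1 : ((A ×ˢ B).filter (fun p => p.1 + p.2 ∈ C)).card ≤ A.card * B.card := by
        rw [← Finset.card_product]
        exact Finset.card_filter_le _ _
      have h2 : (((A ×ˢ B).filter (fun p => p.1 + p.2 ∈ C)).card : ℝ) ≤ A.card * B.card := by
        exact_mod_cast h1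
      have h3 : (A.card : ℝ) + B.card ≤ C.card + 1 := by exact_mod_cast hm
      have h4 : (C.card : ℝ) ≤ A.card + B.card := by exact_mod_cast hC
      nlinarith
    · have hAne : A.Nonempty := Finset.card_pos.mp (by omega)
      have hBne : B.Nonempty := Finset.card_pos.mp (by omega)
      obtain ⟨a, haA, ha⟩ : ∃ a ∈ A, ∀ x ∈ A, a ≤ x :=
        ⟨A.min' hAne, A.min'_mem hAne, fun x hx => A.min'_le x hx⟩
      obtain ⟨b, hbB, hb⟩ : ∃ b ∈ B, ∀ x ∈ B, x ≤ b :=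
        ⟨B.max' hBne, B.max'_mem hBne, fun x hx => B.le_max' x hx⟩
      have cA : (A.erase a).card + 1 = A.card := Finset.card_erase_add_one haA
      have cB : (B.erase b).card + 1 = B.card := Finset.card_erase_add_one hbB
      have key := ih (A.erase a) (B.erase b) (by omega) (by omega) (by omega) (by omega)
      have hS : ((A ×ˢ B).filter
          (fun p => p.1 + p.2 ∈ C ∧ (p.1 = a ∨ p.2 = b))).card ≤ C.card := by
        apply Finset.card_le_card_of_injOn (fun p => p.1 + p.2)
        · intro p hp
          simp only [Finset.coe_filter, Set.mem_setOf_eq] at hp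
          exact hp.2.1
        · rintro ⟨x, y⟩ hp ⟨z, w⟩ hq h
          simp only [Finset.coe_filter, Set.mem_setOf_eq, Finset.mem_product] at hp hq h
          obtain ⟨⟨hx, hy⟩, -, hp⟩ := hp
          obtain ⟨⟨hz, hw⟩, -, hq⟩ := hq
          have := ha x hx
          have := ha z hz
          have := hb y hy
          have := hb w hw
          rw [Prod.mk.injEq]
          rcases hp with hp | hp <;> rcases hq with hq | hq <;> constructor <;> linarith
      have hsub : (A ×ˢ B).filter (fun p => p.1 + p.2 ∈ C) ⊆
          ((A.erase a) ×ˢ (B.erase b)).filter (fun p => p.1 + p.2 ∈ C) ∪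
          (A ×ˢ B).filter (fun p => p.1 + p.2 ∈ C ∧ (p.1 = a ∨ p.2 = b)) := by
        intro p hp
        simp only [Finset.mem_union, Finset.mem_filter, Finset.mem_product,
          Finset.mem_erase] at hp ⊢
        tauto
      have hle := (Finset.card_le_card hsub).trans (Finset.card_union_le _ _)
      have hle2 := hle.trans (Nat.add_le_add_left hS _)
      have hle3 : (((A ×ˢ B).filter (fun p => p.1 + p.2 ∈ C)).card : ℝ) ≤
          (((A.erase a) ×ˢ (B.erase b)).filter (fun p => p.1 + p.2 ∈ C)).card + C.card := by
        exact_mod_cast hle2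
      have cA' : (A.card : ℝ) = (A.erase a).card + 1 := by exact_mod_cast cA.symm
      have cB' : (B.card : ℝ) = (B.erase b).card + 1 := by exact_mod_cast cB.symm
      rw [cA', cB']
      nlinarith

/-- If `A`, `B`, `C` are finite sets of reals with `max(|A|,|B|) ≤ |C| ≤ |A| + |B|`,
then the number of triples `(a,b,c) ∈ A × B × C` with `a + b = c` is at most
`|A||B| - (|A|+|B|-|C|)²/4 + 1/4`. -/
theorem stmt4 (A B C : Finset ℝ)
    (h₁ : max A.card B.card ≤ C.card) (h₂ : C.card ≤ A.card + B.card) :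
    (((A ×ˢ B ×ˢ C).filter (fun p => p.1 + p.2.1 = p.2.2)).card : ℝ) ≤
      (A.card : ℝ) * B.card - ((A.card : ℝ) + B.card - C.card) ^ 2 / 4 + 1 / 4 := by
  refine le_trans ?_ (pair_bound C _ A B rfl (le_trans (le_max_left _ _) h₁)
    (le_trans (le_max_right _ _) h₁) h₂)
  have h : ((A ×ˢ B ×ˢ C).filter (fun p => p.1 + p.2.1 = p.2.2)).card ≤
      ((A ×ˢ B).filter (fun p => p.1 + p.2 ∈ C)).card := by
    apply Finset.card_le_card_of_injOn (fun p => (p.1, p.2.1))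
    · rintro ⟨x, y, z⟩ hp
      simp only [Finset.coe_filter, Set.mem_setOf_eq, Finset.mem_product] at hp ⊢
      obtain ⟨⟨hx, hy, hz⟩, h⟩ := hp
      exact ⟨⟨hx, hy⟩, h ▸ hz⟩
    · rintro ⟨x, y, z⟩ hp ⟨x', y', z'⟩ hq h
      simp only [Finset.coe_filter, Set.mem_setOf_eq, Prod.mk.injEq] at hp hq h ⊢
      obtain ⟨rfl, rfl⟩ := h
      exact ⟨rfl, rfl, hp.2.symm.trans hq.2⟩
  exact_mod_cast h
end

section
/- Let $A$, $B$, and $C$ be finite sets of integers. If $A'$, $B'$, and $C'$ are blocks of consecutive integers such that $|\mathrm{med}(C') - (\mathrm{med}(A') + \mathrm{med}(B'))| \le 0.5$, and $|A'| = |A|$, $|B'| = |B|$, $|C'| = |C|$, then the number of triples $(a,b,c) \in A \times B \times C$ with $a + b = c$ does not exceed the number of triples $(a',b',c') \in A' \times B' \times C'$ with $a' + b' = c'$. -/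
/-- Number of pairs in `A × B` whose sum lies in `C`. -/
def NN (A B C : Finset ℤ) : ℕ := ((A ×ˢ B).filter (fun p => p.1 + p.2 ∈ C)).card

lemma NN_eq (A B C : Finset ℤ) :
    ((A ×ˢ B ×ˢ C).filter (fun p => p.1 + p.2.1 = p.2.2)).card = NN A B C := by
  unfold NN
  refine Finset.card_nbij' (fun p => (p.1, p.2.1)) (fun p => (p.1, p.2, p.1 + p.2)) ?_ ?_ ?_ ?_
  · rintro ⟨a, b, c⟩ h
    simp at h ⊢
    obtain ⟨⟨h1, h2, h3⟩, h4⟩ := h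
    exact ⟨⟨h1, h2⟩, h4 ▸ h3⟩
  · rintro ⟨a, b⟩ h
    simp at h ⊢
    tauto
  · rintro ⟨a, b, c⟩ h
    simp at h ⊢
    exact h.2
  · rintro ⟨a, b⟩ h
    rfl

lemma NN_peel (A B C : Finset ℤ) (M m : ℤ) (hM : ∀ a ∈ A, a ≤ M) (hm : ∀ b ∈ B, m ≤ b) :
    NN A B C ≤ C.card + NN (A.erase M) (B.erase m) C := by
  unfold NN
  set S := (A ×ˢ B).filter (fun p => p.1 + p.2 ∈ C) with hS
  rw [← Finset.card_filter_add_card_filter_not (s := S) (fun p => p.1 = M ∨ p.2 = m)]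
  refine add_le_add ?_ ?_
  · refine Finset.card_le_card_of_injOn (fun p => p.1 + p.2) ?_ ?_
    · rintro ⟨a, b⟩ h
      simp [hS] at h ⊢
      tauto
    · rintro ⟨a, b⟩ h ⟨a', b'⟩ h' e
      simp [hS] at h h' e ⊢
      have := hM a h.1.1.1
      have := hm b h.1.1.2
      have := hM a' h'.1.1.1
      have := hm b' h'.1.1.2
      omega
  · refine Finset.card_le_card ?_
    rintro ⟨a, b⟩ h
    simp [hS] at h ⊢
    tauto

lemma NN_block (a₁ a₂ b₁ b₂ c₁ c₂ : ℤ) (ha : a₁ ≤ a₂) (hb : b₁ ≤ b₂)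
    (h1 : a₁ + b₁ ≤ c₁) (h2 : c₂ ≤ a₂ + b₂) :
    (Finset.Icc c₁ c₂).card +
      NN (Finset.Icc a₁ (a₂ - 1)) (Finset.Icc (b₁ + 1) b₂) (Finset.Icc c₁ c₂) ≤
      NN (Finset.Icc a₁ a₂) (Finset.Icc b₁ b₂) (Finset.Icc c₁ c₂) := by
  unfold NN
  set S := (Finset.Icc a₁ a₂ ×ˢ Finset.Icc b₁ b₂).filter
    (fun p => p.1 + p.2 ∈ Finset.Icc c₁ c₂) with hS
  rw [← Finset.card_filter_add_card_filter_not (s := S) (fun p => p.1 = a₂ ∨ p.2 = b₁)]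
  refine add_le_add ?_ ?_
  · refine Finset.card_le_card_of_injOn
      (fun c => if c ≤ a₂ + b₁ then (c - b₁, b₁) else (a₂, c - a₂)) ?_ ?_
    · intro c h
      simp at h
      by_cases hc : c ≤ a₂ + b₁
      · simp [hS, hc]
        omega
      · simp [hS, hc]
        omega
    · intro c h c' h' e
      by_cases hc : c ≤ a₂ + b₁ <;> by_cases hc' : c' ≤ a₂ + b₁ <;>
        simp [hc, hc'] at e <;> omega
  · refine Finset.card_le_card ?_
    rintro ⟨a, b⟩ h
    simp [hS] at h ⊢
    omega

lemma NN_main (n : ℕ) : ∀ (A B C : Finset ℤ) (a₁ a₂ b₁ b₂ c₁ c₂ : ℤ), A.card = n →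
    (A.card : ℤ) = a₂ + 1 - a₁ → (B.card : ℤ) = b₂ + 1 - b₁ →
    (Finset.Icc c₁ c₂).card = C.card →
    |c₁ + c₂ - (a₁ + a₂ + b₁ + b₂)| ≤ 1 →
    NN A B C ≤ NN (Finset.Icc a₁ a₂) (Finset.Icc b₁ b₂) (Finset.Icc c₁ c₂) := by
  induction n with
  | zero =>
    intro A B C a₁ a₂ b₁ b₂ c₁ c₂ h0 _ _ _ _
    rw [Finset.card_eq_zero] at h0
    subst h0
    simp [NN]
  | succ n ih =>
    intro A B C a₁ a₂ b₁ b₂ c₁ c₂ h0 hA hB hC hm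
    have hAne : A.Nonempty := by rw [← Finset.card_pos]; omega
    rcases B.eq_empty_or_nonempty with rfl | hBne
    · simp [NN]
    have hBpos := Finset.card_pos.2 hBne
    have hm' := abs_le.1 hm
    by_cases hcase : a₁ + b₁ ≤ c₁ ∧ c₂ ≤ a₂ + b₂
    · have e1 := NN_peel A B C (A.max' hAne) (B.min' hBne)
        (fun a h => A.le_max' a h) (fun b h => B.min'_le b h)
      have e2 := NN_block a₁ a₂ b₁ b₂ c₁ c₂ (by omega) (by omega) hcase.1 hcase.2
      have k1 := Finset.card_erase_of_mem (A.max'_mem hAne)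
      have k2 := Finset.card_erase_of_mem (B.min'_mem hBne)
      have e3 := ih (A.erase (A.max' hAne)) (B.erase (B.min' hBne)) C a₁ (a₂ - 1) (b₁ + 1) b₂
        c₁ c₂ (by omega) (by omega) (by omega) hC (by rw [abs_le]; omega)
      omega
    · calc NN A B C ≤ (A ×ˢ B).card := Finset.card_filter_le _ _
        _ = (Finset.Icc a₁ a₂ ×ˢ Finset.Icc b₁ b₂).card := by
          rw [Finset.card_product, Finset.card_product, Int.card_Icc, Int.card_Icc, ← hA, ← hB]
          simp
        _ ≤ _ := by
          unfold NN
          rw [Finset.filter_true_of_mem]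
          rintro ⟨a, b⟩ h
          simp at h ⊢
          omega

/-- Let `A, B, C` be finite sets of integers, and let `A' = [a₁, a₂]`, `B' = [b₁, b₂]`,
`C' = [c₁, c₂]` be blocks of consecutive integers with `|A'| = |A|`, `|B'| = |B|`,
`|C'| = |C|`, such that `med(C')` is at most `0.5` off from `med(A') + med(B')`,
where `med(X) = (min X + max X)/2`. Then the number of triples `(a,b,c) ∈ A × B × C`
with `a + b = c` does not exceed the number of triples `(a',b',c') ∈ A' × B' × C'`
with `a' + b' = c'`. -/
theorem stmt5 (A B C : Finset ℤ) (a₁ a₂ b₁ b₂ c₁ c₂ : ℤ)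
    (ha : a₁ ≤ a₂) (hb : b₁ ≤ b₂) (hc : c₁ ≤ c₂)
    (hA : (Finset.Icc a₁ a₂).card = A.card)
    (hB : (Finset.Icc b₁ b₂).card = B.card)
    (hC : (Finset.Icc c₁ c₂).card = C.card)
    (hmed : |((c₁ : ℝ) + c₂) / 2 - (((a₁ : ℝ) + a₂) / 2 + ((b₁ : ℝ) + b₂) / 2)| ≤ 0.5) :
    ((A ×ˢ B ×ˢ C).filter (fun p => p.1 + p.2.1 = p.2.2)).card ≤
      ((Finset.Icc a₁ a₂ ×ˢ Finset.Icc b₁ b₂ ×ˢ Finset.Icc c₁ c₂).filter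
        (fun p => p.1 + p.2.1 = p.2.2)).card := by
  rw [NN_eq, NN_eq]
  rw [Int.card_Icc] at hA hB
  refine NN_main A.card A B C a₁ a₂ b₁ b₂ c₁ c₂ rfl (by omega) (by omega) hC ?_
  have h : |((c₁ : ℝ) + c₂ - (a₁ + a₂ + b₁ + b₂))| ≤ 1 := by
    rw [abs_le] at hmed ⊢
    norm_num at hmed
    constructor <;> linarith [hmed.1, hmed.2]
  exact_mod_cast h
end

section
/- For all real numbers $x_0, x_1, y_0, y_1 \ge 0$ with $\tfrac{1}{2} \le s \le 1$, where $s := x_0 + x_1 + y_0 + y_1$, one has $f(x_0, x_1, y_0, y_1) \le 0.15$. -/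
/-- `G x y z = ξη` if `ζ ≥ ξ + η`, and `ξη - (ξ+η-ζ)²/4` if `ζ ≤ ξ + η`,
where `(ξ, η, ζ)` is a non-decreasing rearrangement of `(x, y, z)`. -/
noncomputable def G (x y z : ℝ) : ℝ :=
  let ξ := min x (min y z)
  let ζ := max x (max y z)
  let η := x + y + z - ξ - ζ
  if ζ ≥ ξ + η then ξ * η else ξ * η - (ξ + η - ζ) ^ 2 / 4

/-- With `s := x₀ + x₁ + y₀ + y₁`,
`f(x₀,x₁,y₀,y₁) := min{0.15 s², x₀y₀ + x₁y₁} + G(x₀, y₁, 1-s) + G(x₁, y₀, 1-s) + 0.25(1-s)²`. -/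
noncomputable def f (x₀ x₁ y₀ y₁ : ℝ) : ℝ :=
  let s := x₀ + x₁ + y₀ + y₁
  min (0.15 * s ^ 2) (x₀ * y₀ + x₁ * y₁) + G x₀ y₁ (1 - s) + G x₁ y₀ (1 - s)
    + 0.25 * (1 - s) ^ 2

/-- The three possible shapes of `G`, in terms of `p = x + y` and `u = |x - y|`. -/
lemma G_cases (x y t : ℝ) :
    (|x - y| ≤ t ∧ G x y t = (2 * (x + y) * t - t ^ 2 - |x - y| ^ 2) / 4) ∨
    (t ≤ |x - y| ∧ G x y t = (x + y - |x - y|) * t / 2) ∨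
    (x + y ≤ t ∧ G x y t = ((x + y) ^ 2 - |x - y| ^ 2) / 4) := by
  rw [sq_abs]
  unfold G
  rcases le_total x y with h1 | h1 <;> rcases le_total y t with h2 | h2 <;>
  rcases le_total x t with h3 | h3 <;>
  simp only [h1, h2, h3, min_eq_left, min_eq_right, max_eq_left, max_eq_right] <;>
  (first | rw [abs_of_nonpos (by linarith : x - y ≤ 0)]
         | rw [abs_of_nonneg (by linarith : 0 ≤ x - y)]) <;>
  split_ifs with h <;>
  first
  | (left; exact ⟨by linarith, by ring1⟩)
  | (right; left; exact ⟨by linarith, by ring1⟩)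
  | (right; right; exact ⟨by linarith, by ring1⟩)
  | (have e1 : y = x := by linarith
     have e2 : t = x := by linarith
     rw [e1, e2] at *
     first
     | (left; exact ⟨by linarith, by ring1⟩)
     | (right; left; exact ⟨by linarith, by ring1⟩))

/-- Both `G`-terms in the "product with `t`" regime. -/
lemma key_tt (s w t M : ℝ) (hs : 0 ≤ s) (ht : 0 ≤ t) (hts : t ≤ s) (hw : 2 * t ≤ w)
    (hws : w ≤ s) (h1 : M ≤ 0.15 * s ^ 2) (h2 : M ≤ s ^ 2 / 8 + w ^ 2 / 8) :
    M + (s - w) * t / 2 + t ^ 2 / 4 ≤ 0.15 * (s + t) ^ 2 := by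
  rcases le_total (9 * t) (2 * s) with h | h
  · rcases le_total (0.4475 * s) w with h' | h'
    · nlinarith [mul_nonneg ht (sub_nonneg.2 h), mul_nonneg ht (sub_nonneg.2 h')]
    · nlinarith [mul_nonneg (sub_nonneg.2 hw) (sub_nonneg.2 h'), sq_nonneg (s - 4 * t),
        mul_nonneg ht (sub_nonneg.2 h), mul_nonneg ht hs, sq_nonneg t, sq_nonneg s]
  · nlinarith [mul_nonneg ht (sub_nonneg.2 h), mul_nonneg ht (sub_nonneg.2 hw)]

lemma key (p q u v t M A B : ℝ) (hu : 0 ≤ u) (hv : 0 ≤ v) (hup : u ≤ p) (hvq : v ≤ q)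
    (ht : 0 ≤ t) (hts : t ≤ p + q) (h1 : M ≤ 0.15 * (p + q) ^ 2) (h2 : M ≤ (p * q + u * v) / 2)
    (hA : (u ≤ t ∧ A = (2 * p * t - t ^ 2 - u ^ 2) / 4) ∨ (t ≤ u ∧ A = (p - u) * t / 2) ∨
      (p ≤ t ∧ A = (p ^ 2 - u ^ 2) / 4))
    (hB : (v ≤ t ∧ B = (2 * q * t - t ^ 2 - v ^ 2) / 4) ∨ (t ≤ v ∧ B = (q - v) * t / 2) ∨
      (q ≤ t ∧ B = (q ^ 2 - v ^ 2) / 4)) :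
    M + A + B + t ^ 2 / 4 ≤ 0.15 * (p + q + t) ^ 2 := by
  have e1 := sq_nonneg (p + q - 4 * t)
  have e2 := sq_nonneg (p - q)
  have e3 := sq_nonneg (u - v)
  rcases hA with ⟨a, rfl⟩ | ⟨a, rfl⟩ | ⟨a, rfl⟩ <;> rcases hB with ⟨b, rfl⟩ | ⟨b, rfl⟩ | ⟨b, rfl⟩
  · nlinarith
  · nlinarith [mul_nonneg (sub_nonneg.2 a) (sub_nonneg.2 b), sq_nonneg (u - t)]
  · nlinarith [sq_nonneg (p - 2 / 3 * (q + t)), mul_nonneg (hv.trans hvq) (sub_nonneg.2 b), sq_nonneg t,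
      mul_nonneg (hv.trans hvq) ht]
  · nlinarith [mul_nonneg (sub_nonneg.2 a) (sub_nonneg.2 b), sq_nonneg (v - t)]
  · have := key_tt (p + q) (u + v) t M (by linarith) ht hts (by linarith) (by linarith) h1
      (by nlinarith)
    linarith
  · nlinarith [sq_nonneg (p - 2 / 3 * (q + t)), mul_nonneg (hv.trans hvq) (sub_nonneg.2 b), sq_nonneg t,
      mul_nonneg (sub_nonneg.2 a) (sub_nonneg.2 (hvq.trans b)), sq_nonneg (t - v),
      mul_nonneg (hv.trans hvq) ht]
  · nlinarith [sq_nonneg (q - 2 / 3 * (p + t)), mul_nonneg (hu.trans hup) (sub_nonneg.2 a), sq_nonneg t,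
      mul_nonneg (hu.trans hup) ht]
  · nlinarith [sq_nonneg (q - 2 / 3 * (p + t)), mul_nonneg (hu.trans hup) (sub_nonneg.2 a), sq_nonneg t,
      mul_nonneg (sub_nonneg.2 b) (sub_nonneg.2 (hup.trans a)), sq_nonneg (t - u),
      mul_nonneg (hu.trans hup) ht]
  · nlinarith [mul_nonneg (sub_nonneg.2 hts) (by linarith : 0 ≤ 2 * t - (p + q)), mul_nonneg ht (sub_nonneg.2 hts), mul_nonneg ht ht]

theorem stmt10 (x₀ x₁ y₀ y₁ : ℝ) (hx₀ : 0 ≤ x₀) (hx₁ : 0 ≤ x₁) (hy₀ : 0 ≤ y₀)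
    (hy₁ : 0 ≤ y₁) (hs₁ : 1 / 2 ≤ x₀ + x₁ + y₀ + y₁) (hs₂ : x₀ + x₁ + y₀ + y₁ ≤ 1) :
    f x₀ x₁ y₀ y₁ ≤ 0.15 := by
  have h := key (x₀ + y₁) (x₁ + y₀) |x₀ - y₁| |x₁ - y₀| (1 - (x₀ + x₁ + y₀ + y₁))
    (min (0.15 * (x₀ + x₁ + y₀ + y₁) ^ 2) (x₀ * y₀ + x₁ * y₁)) _ _ (abs_nonneg _) (abs_nonneg _)
    (abs_le.2 ⟨by linarith, by linarith⟩) (abs_le.2 ⟨by linarith, by linarith⟩) (by linarith)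
    (by linarith) ((min_le_left _ _).trans (le_of_eq (by ring)))
    ((min_le_right _ _).trans (by
      rw [← abs_mul]; nlinarith [neg_abs_le ((x₀ - y₁) * (x₁ - y₀))]))
    (G_cases _ _ _) (G_cases _ _ _)
  unfold f
  have e : (0.15 : ℝ) * (x₀ + y₁ + (x₁ + y₀) + (1 - (x₀ + x₁ + y₀ + y₁))) ^ 2 = 0.15 := by ring
  rw [e] at h
  simp only
  linarith
end

section
/- For all real numbers $x_0, x_1 \ge 0$ with $s := 2(x_0 + x_1) \in [1/2, 1]$, one has $f(x_0, x_1, x_1, x_0) \le 0.15$; equivalently, $\min\{0.15 s^2, 2 x_0 x_1\} + G(x_0, x_0, 1-s) + G(x_1, x_1, 1-s) + 0.25(1-s)^2 \le 0.15$. -/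
lemma G_diag_le (x z : ℝ) (hz : 0 ≤ z) (h : z ≤ 2 * x) :
    G x x z = x * z - z ^ 2 / 4 := by
  have hx : 0 ≤ x := by linarith
  unfold G
  rcases le_total z x with h1 | h1
  · simp only [min_eq_right h1, max_eq_left h1, max_self]
    split_ifs with h2
    · have : z = 0 := by linarith
      subst this; ring
    · ring
  · simp only [min_eq_left h1, max_eq_right h1, min_self]
    split_ifs with h2
    · have : z = 2 * x := by linarith
      subst this; ring
    · ring

lemma G_diag_ge (x z : ℝ) (hx : 0 ≤ x) (h : 2 * x ≤ z) : G x x z = x ^ 2 := by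
  have h1 : x ≤ z := by linarith
  unfold G
  simp only [min_eq_left h1, max_eq_right h1, min_self]
  rw [if_pos (by linarith)]; ring

lemma main_ineq (x₀ x₁ : ℝ) (hx₀ : 0 ≤ x₀) (hx₁ : 0 ≤ x₁)
    (hs₁ : 1 / 2 ≤ 2 * (x₀ + x₁)) (hs₂ : 2 * (x₀ + x₁) ≤ 1) :
    2 * (x₀ * x₁)
        + G x₀ x₀ (1 - 2 * (x₀ + x₁)) + G x₁ x₁ (1 - 2 * (x₀ + x₁))
        + 0.25 * (1 - 2 * (x₀ + x₁)) ^ 2 ≤ 0.15 := by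
  have hz : 0 ≤ 1 - 2 * (x₀ + x₁) := by linarith
  rcases le_total (1 - 2 * (x₀ + x₁)) (2 * x₀) with h0 | h0 <;>
  rcases le_total (1 - 2 * (x₀ + x₁)) (2 * x₁) with h1 | h1
  · rw [G_diag_le _ _ hz h0, G_diag_le _ _ hz h1]
    nlinarith [sq_nonneg (x₀ - x₁), sq_nonneg (x₀ + x₁ - 0.4)]
  · rw [G_diag_le _ _ hz h0, G_diag_ge _ _ hx₁ h1]
    have : x₁ ^ 2 ≤ ((1 - 2 * x₀) / 4) ^ 2 := pow_le_pow_left₀ hx₁ (by linarith) 2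
    nlinarith [sq_nonneg (x₀ - 3 / 14)]
  · rw [G_diag_ge _ _ hx₀ h0, G_diag_le _ _ hz h1]
    have : x₀ ^ 2 ≤ ((1 - 2 * x₁) / 4) ^ 2 := pow_le_pow_left₀ hx₀ (by linarith) 2
    nlinarith [sq_nonneg (x₁ - 3 / 14)]
  · rw [G_diag_ge _ _ hx₀ h0, G_diag_ge _ _ hx₁ h1]
    have h2 : x₀ + x₁ ≤ 1 / 3 := by linarith
    nlinarith [mul_nonneg (sub_nonneg.2 h2) (show 0 ≤ x₀ + x₁ - 1 / 4 by linarith)]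


/-- For all `x₀, x₁ ≥ 0` with `s := 2(x₀+x₁) ∈ [1/2, 1]`, one has
`f(x₀, x₁, x₁, x₀) ≤ 0.15`; equivalently,
`min{0.15 s², 2x₀x₁} + G(x₀, x₀, 1-s) + G(x₁, x₁, 1-s) + 0.25(1-s)² ≤ 0.15`. -/
theorem stmt11 (x₀ x₁ : ℝ) (hx₀ : 0 ≤ x₀) (hx₁ : 0 ≤ x₁)
    (hs₁ : 1 / 2 ≤ 2 * (x₀ + x₁)) (hs₂ : 2 * (x₀ + x₁) ≤ 1) :
    f x₀ x₁ x₁ x₀ ≤ 0.15 ∧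
      min (0.15 * (2 * (x₀ + x₁)) ^ 2) (2 * (x₀ * x₁))
        + G x₀ x₀ (1 - 2 * (x₀ + x₁)) + G x₁ x₁ (1 - 2 * (x₀ + x₁))
        + 0.25 * (1 - 2 * (x₀ + x₁)) ^ 2 ≤ 0.15 := by
  have key : min (0.15 * (2 * (x₀ + x₁)) ^ 2) (2 * (x₀ * x₁))
        + G x₀ x₀ (1 - 2 * (x₀ + x₁)) + G x₁ x₁ (1 - 2 * (x₀ + x₁))
        + 0.25 * (1 - 2 * (x₀ + x₁)) ^ 2 ≤ 0.15 := by
    have h := main_ineq x₀ x₁ hx₀ hx₁ hs₁ hs₂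
    have h' := min_le_right (0.15 * (2 * (x₀ + x₁)) ^ 2) (2 * (x₀ * x₁))
    linarith
  refine ⟨?_, key⟩
  unfold f
  have e1 : x₀ + x₁ + x₁ + x₀ = 2 * (x₀ + x₁) := by ring
  have e2 : x₀ * x₁ + x₁ * x₀ = 2 * (x₀ * x₁) := by ring
  simp only [e1, e2]
  exact key
end

section
/- For all real numbers $x_0, x_1, y_0, y_1 \ge 0$ satisfying $3(x_0 + y_0) + (x_1 + y_1) \ge 2$ and $s \le 1$, where $s := x_0 + x_1 + y_0 + y_1$, one has $g(x_0, x_1, y_0, y_1) \le 0.15$. -/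
/-- With `s := x₀ + x₁ + y₀ + y₁`,
`g(x₀,x₁,y₀,y₁) := min{0.15 s², x₀y₀ + x₁y₁} + (x₁+y₁)(1-s) + 0.25(1-s)²`. -/
noncomputable def g (x₀ x₁ y₀ y₁ : ℝ) : ℝ :=
  let s := x₀ + x₁ + y₀ + y₁
  min (0.15 * s ^ 2) (x₀ * y₀ + x₁ * y₁) + (x₁ + y₁) * (1 - s) + 0.25 * (1 - s) ^ 2

/-- Convexity in `b` between the two endpoints. -/
theorem key_aux (b t : ℝ) (h2 : t ≤ 2 / 11) (h : 3 / 10 - 2 / 5 * t ≤ b)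
    (hbt : b ≤ (1 - 3 * t) / 2) :
    ((1 - t - b) ^ 2 + b ^ 2) / 4 + b * t + 1 / 4 * t ^ 2 ≤ 3 / 20 := by
  have hL : 0 ≤ 1 / 200 - 3 / 100 * t + 1 / 50 * t ^ 2 := by
    linarith [sq_nonneg (t - 2 / 11)]
  have hR : 0 ≤ 1 / 40 - 1 / 4 * t + 5 / 8 * t ^ 2 := by
    linarith [sq_nonneg (t - 1 / 5)]
  rcases eq_or_lt_of_le (h.trans hbt) with hd | hd
  · have e : b = (1 - 3 * t) / 2 := by linarith
    subst e
    linarith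
  · by_contra hc
    push Not at hc
    have m1 := mul_nonneg (sub_nonneg.2 hbt) hL
    have m2 := mul_nonneg (sub_nonneg.2 h) hR
    have m3 := mul_pos (sub_pos.2 hd) (sub_pos.2 hc)
    have m4 := mul_nonneg (sub_pos.2 hd).le (mul_nonneg (sub_nonneg.2 h) (sub_nonneg.2 hbt))
    linarith

/-- For all `x₀, x₁, y₀, y₁ ≥ 0` with `3(x₀+y₀) + (x₁+y₁) ≥ 2` and
`s := x₀+x₁+y₀+y₁ ≤ 1`, one has `g(x₀,x₁,y₀,y₁) ≤ 0.15`. -/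
theorem stmt12 (x₀ x₁ y₀ y₁ : ℝ) (hx₀ : 0 ≤ x₀) (hx₁ : 0 ≤ x₁) (hy₀ : 0 ≤ y₀)
    (hy₁ : 0 ≤ y₁) (h312 : 3 * (x₀ + y₀) + (x₁ + y₁) ≥ 2)
    (hs : x₀ + x₁ + y₀ + y₁ ≤ 1) :
    g x₀ x₁ y₀ y₁ ≤ 0.15 := by
  obtain ⟨b, hb⟩ : ∃ b, b = x₁ + y₁ := ⟨_, rfl⟩
  obtain ⟨t, ht⟩ : ∃ t, t = 1 - (x₀ + x₁ + y₀ + y₁) := ⟨_, rfl⟩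
  have hb0 : 0 ≤ b := by linarith
  have ht0 : 0 ≤ t := by linarith
  have hbt : b ≤ (1 - 3 * t) / 2 := by linarith
  have hS : x₀ + x₁ + y₀ + y₁ = 1 - t := by linarith
  have hq : x₀ * y₀ + x₁ * y₁ ≤ ((1 - t - b) ^ 2 + b ^ 2) / 4 := by
    have e : 1 - t - b = x₀ + y₀ := by linarith
    rw [e, hb]
    nlinarith [sq_nonneg (x₀ - y₀), sq_nonneg (x₁ - y₁)]
  unfold g
  simp only [hS, ← hb]
  by_cases h : b ≤ 0.3 - 0.4 * t
  · have h1 := min_le_left (3 / 20 * (1 - t) ^ 2) (x₀ * y₀ + x₁ * y₁)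
    norm_num at h ⊢
    nlinarith [mul_nonneg ht0 (sub_nonneg.2 h)]
  · have h1 := min_le_right (3 / 20 * (1 - t) ^ 2) (x₀ * y₀ + x₁ * y₁)
    norm_num at h ⊢
    have h2 : t ≤ 2 / 11 := by linarith
    have key := key_aux b t h2 h.le hbt
    linarith
end

section
/- If $A$ is a finite set of real numbers, then the number of triples $(a,b,c) \in A \times A \times A$ with $a + b = 2c$ is at most $0.5|A|^2 + 0.5$. -/
theorem stmt13_nat (n : ℕ) : ∀ A : Finset ℝ, A.card = n →
    2 * ((A ×ˢ A ×ˢ A).filter (fun p => p.1 + p.2.1 = 2 * p.2.2)).card ≤ n ^ 2 + 1 := by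
  induction n using Nat.strong_induction_on with
  | _ n ih =>
    intro A hA
    rcases A.eq_empty_or_nonempty with h0 | hne
    · subst h0
      simp
    obtain ⟨M, hM, hMx⟩ := A.exists_max_image id hne
    obtain ⟨m, hm, hmn⟩ := A.exists_min_image id hne
    simp only [id] at hMx hmn
    by_cases hmM : m = M
    · have hs : (A ×ˢ A ×ˢ A).filter (fun p => p.1 + p.2.1 = 2 * p.2.2) ⊆ {(M, M, M)} := by
        rintro ⟨a, b, c⟩ h
        simp only [Finset.mem_filter, Finset.mem_product] at h
        obtain ⟨⟨ha, hb, hc⟩, -⟩ := h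
        have e : ∀ x ∈ A, x = M := fun x hx =>
          le_antisymm (hMx x hx) (hmM ▸ hmn x hx)
        simp [e a ha, e b hb, e c hc]
      have h1 := Finset.card_le_card hs
      rw [Finset.card_singleton] at h1
      have h2 : 0 < n := hA ▸ Finset.card_pos.mpr hne
      have : 0 < n ^ 2 := by positivity
      omega
    · set B := (A.erase M).erase m with hB
      have hmA : m ∈ A.erase M := Finset.mem_erase.mpr ⟨hmM, hm⟩
      have c1 := Finset.card_erase_add_one hM
      have c2 := Finset.card_erase_add_one hmA
      have hBc : B.card + 2 = n := by
        rw [hB]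
        omega
      have hI := ih B.card (by omega) B rfl
      let g : ℝ → ℝ × ℝ × ℝ := fun c => if M + m ≤ 2 * c then (2 * c - M, M, c) else (m, 2 * c - m, c)
      let g' : ℝ → ℝ × ℝ × ℝ := fun c => if M + m ≤ 2 * c then (M, 2 * c - M, c) else (2 * c - m, m, c)
      have hs : (A ×ˢ A ×ˢ A).filter (fun p => p.1 + p.2.1 = 2 * p.2.2) ⊆
          (B ×ˢ B ×ˢ B).filter (fun p => p.1 + p.2.1 = 2 * p.2.2) ∪
            ({(M, M, M), (m, m, m)} ∪ (B.image g ∪ B.image g')) := by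
        rintro ⟨a, b, c⟩ h
        simp only [Finset.mem_filter, Finset.mem_product] at h
        obtain ⟨⟨ha, hb, hc⟩, he⟩ := h
        have a1 := hMx a ha
        have a2 := hmn a ha
        have b1 := hMx b hb
        have b2 := hmn b hb
        simp only [Finset.mem_union, Finset.mem_insert, Finset.mem_singleton, Prod.mk.injEq]
        by_cases hcM : c = M
        · right; left; left
          refine ⟨?_, ?_, hcM⟩ <;> linarith
        by_cases hcm : c = m
        · right; left; right
          refine ⟨?_, ?_, hcm⟩ <;> linarith
        have hcB : c ∈ B := by simp [hB, hcM, hcm, hc]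
        by_cases hab : a ∈ B ∧ b ∈ B
        · left
          simp [hab, hcB, he]
        right; right
        have h4 : a = M ∨ a = m ∨ b = M ∨ b = m := by
          by_contra! hcon
          exact hab ⟨by simp [hB, hcon, ha], by simp [hB, hcon, hb]⟩
        have key : (a, b, c) = g c ∨ (a, b, c) = g' c := by
          simp only [g, g']
          split_ifs with hle
          · simp only [Prod.mk.injEq, and_true]
            rcases h4 with h | h | h | h
            · right; constructor <;> linarith
            · left; constructor <;> linarith
            · left; constructor <;> linarith
            · right; constructor <;> linarith
          · simp only [Prod.mk.injEq, and_true]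
            rcases h4 with h | h | h | h
            · exfalso; linarith
            · left; constructor <;> linarith
            · exfalso; linarith
            · right; constructor <;> linarith
        rcases key with k | k
        · left; rw [k]; exact Finset.mem_image_of_mem g hcB
        · right; rw [k]; exact Finset.mem_image_of_mem g' hcB
      have h1 := Finset.card_le_card hs
      have h2 := Finset.card_union_le ((B ×ˢ B ×ˢ B).filter (fun p => p.1 + p.2.1 = 2 * p.2.2))
            ({(M, M, M), (m, m, m)} ∪ (B.image g ∪ B.image g'))
      have h3 := Finset.card_union_le ({(M, M, M), (m, m, m)} : Finset (ℝ × ℝ × ℝ))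
        (B.image g ∪ B.image g')
      have h4 := Finset.card_union_le (B.image g) (B.image g')
      have h5 := Finset.card_image_le (s := B) (f := g)
      have h6 := Finset.card_image_le (s := B) (f := g')
      have h7 := Finset.card_le_two (a := (M, M, M)) (b := (m, m, m))
      rw [← hBc]
      nlinarith

/-- If `A` is a finite set of real numbers, then the number of triples
`(a,b,c) ∈ A × A × A` with `a + b = 2c` is at most `0.5|A|² + 0.5`. -/
theorem stmt13 (A : Finset ℝ) :
    (((A ×ˢ A ×ˢ A).filter (fun p => p.1 + p.2.1 = 2 * p.2.2)).card : ℝ) ≤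
      0.5 * (A.card : ℝ) ^ 2 + 0.5 := by
  have h := stmt13_nat A.card A rfl
  have h' : (2 : ℝ) * (((A ×ˢ A ×ˢ A).filter (fun p => p.1 + p.2.1 = 2 * p.2.2)).card : ℝ) ≤
      (A.card : ℝ) ^ 2 + 1 := by exact_mod_cast h
  linarith
end

section
/- Let $m \ge 2$ be an even integer and let $A = \{1, 2, \ldots, m\} \cup \{m+2, m+4, \ldots, 4m\}$ (the integers from $1$ to $m$ together with the even integers from $m+2$ to $4m$). Then $|A| = 5m/2$, and the number of triples $(a,b,c) \in A \times A \times A$ with $a - b = 2c$ equals $\tfrac{15}{8}m^2 - \tfrac{5}{4}m$, which equals $\tfrac{3}{10}|A|^2 - \tfrac{1}{2}|A|$. -/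
lemma aux_gauss (n : ℕ) : ((∑ i ∈ Finset.range n, i : ℕ) : ℝ) = n * (n - 1) / 2 := by
  induction n with
  | zero => simp
  | succ n ih => rw [Finset.sum_range_succ]; push_cast at ih ⊢; rw [ih]; ring

lemma aux_card_sigma (n : ℕ) (f : ℕ → ℕ) (g : (Σ _ : ℕ, ℕ) → ℤ × ℤ × ℤ)
    (hg : ∀ i j i' j' : ℕ, g ⟨i, j⟩ = g ⟨i', j'⟩ → i = i' ∧ j = j') :
    (((Finset.range n).sigma (fun i => Finset.range (f i))).image g).card
      = ∑ i ∈ Finset.range n, f i := by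
  rw [Finset.card_image_of_injective, Finset.card_sigma]
  · simp
  · rintro ⟨i, j⟩ ⟨i', j'⟩ h
    obtain ⟨rfl, rfl⟩ := hg _ _ _ _ h
    rfl

lemma aux_mem (k : ℕ) (x : ℤ) :
    x ∈ (Finset.Icc 1 (2 * (k : ℤ)) ∪
      (Finset.Icc (2 * (k : ℤ) + 1) (4 * (2 * (k : ℤ)))).filter (fun x => Even x)) ↔
      1 ≤ x ∧ x ≤ 8 * k ∧ (x ≤ 2 * k ∨ x % 2 = 0) := by
  simp only [Finset.mem_union, Finset.mem_Icc, Finset.mem_filter, Int.even_iff]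
  omega

/-- Let `m ≥ 2` be an even integer and
`A = {1, …, m} ∪ {m+2, m+4, …, 4m}` (the integers from `1` to `m` and the even
integers from `m+2` to `4m`). Then `|A| = 5m/2`, and the number of triples
`(a,b,c) ∈ A × A × A` with `a - b = 2c` equals `15m²/8 - 5m/4 = 3|A|²/10 - |A|/2`. -/
theorem stmt14 (m : ℤ) (hm : 2 ≤ m) (hme : Even m)
    (A : Finset ℤ)
    (hA : A = Finset.Icc 1 m ∪ (Finset.Icc (m + 1) (4 * m)).filter (fun x => Even x)) :
    (A.card : ℝ) = 5 * (m : ℝ) / 2 ∧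
    ((((A ×ˢ A ×ˢ A).filter (fun p => p.1 - p.2.1 = 2 * p.2.2)).card : ℝ)
        = 15 / 8 * (m : ℝ) ^ 2 - 5 / 4 * (m : ℝ)) ∧
    ((((A ×ˢ A ×ˢ A).filter (fun p => p.1 - p.2.1 = 2 * p.2.2)).card : ℝ)
        = 3 / 10 * (A.card : ℝ) ^ 2 - 1 / 2 * (A.card : ℝ)) := by
  obtain ⟨k, rfl⟩ : ∃ k : ℕ, m = 2 * (k : ℤ) := by
    obtain ⟨r, hr⟩ := hme
    exact ⟨r.toNat, by omega⟩
  have hmem : ∀ x, x ∈ A ↔ 1 ≤ x ∧ x ≤ 8 * k ∧ (x ≤ 2 * k ∨ x % 2 = 0) := by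
    intro x; rw [hA]; exact aux_mem k x
  clear hA
  have hcard : (A.card : ℝ) = 5 * k := by
    have h : A = (Finset.range k).image (fun i : ℕ => 2 * (i : ℤ) + 1) ∪
        (Finset.range (4 * k)).image (fun i : ℕ => 2 * (i : ℤ) + 2) := by
      ext x
      simp only [hmem, Finset.mem_union, Finset.mem_image, Finset.mem_range]
      constructor
      · intro h
        by_cases hx : x % 2 = 0
        · exact Or.inr ⟨((x - 2) / 2).toNat, by omega, by omega⟩
        · exact Or.inl ⟨((x - 1) / 2).toNat, by omega, by omega⟩
      · rintro (⟨i, hi, rfl⟩ | ⟨i, hi, rfl⟩) <;> omega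
    rw [h, Finset.card_union_of_disjoint, Finset.card_image_of_injective,
      Finset.card_image_of_injective]
    · simp only [Finset.card_range]; push_cast; ring
    · intro a b h; simp only at h; omega
    · intro a b h; simp only at h; omega
    · rw [Finset.disjoint_left]
      simp only [Finset.mem_image, Finset.mem_range]
      rintro x ⟨i, hi, rfl⟩ ⟨j, hj, h⟩
      omega
  have hT : ((((A ×ˢ A ×ˢ A).filter (fun p => p.1 - p.2.1 = 2 * p.2.2)).card : ℝ)
      = 15 / 2 * (k : ℝ) ^ 2 - 5 / 2 * (k : ℝ)) := by
    set g1 : (Σ _ : ℕ, ℕ) → ℤ × ℤ × ℤ :=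
      fun s => (2 * (s.1 : ℤ) + 1, 2 * (s.2 : ℤ) + 1, (s.1 : ℤ) - s.2) with hg1
    set g2 : (Σ _ : ℕ, ℕ) → ℤ × ℤ × ℤ :=
      fun s => (2 * (s.2 : ℤ) + 2 + 2 * (2 * k - s.1), 2 * (s.2 : ℤ) + 2, 2 * (k : ℤ) - s.1)
      with hg2
    set g3 : (Σ _ : ℕ, ℕ) → ℤ × ℤ × ℤ :=
      fun s => (2 * (s.2 : ℤ) + 2 + 2 * (4 * k - 2 * s.1), 2 * (s.2 : ℤ) + 2,
        4 * (k : ℤ) - 2 * s.1) with hg3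
    have h : (A ×ˢ A ×ˢ A).filter (fun p => p.1 - p.2.1 = 2 * p.2.2) =
        (((Finset.range k).sigma (fun i => Finset.range i)).image g1 ∪
        ((Finset.range (2 * k)).sigma (fun i => Finset.range (2 * k + i))).image g2) ∪
        ((Finset.range k).sigma (fun i => Finset.range (2 * i))).image g3 := by
      ext ⟨a, b, c⟩
      simp only [hmem, Finset.mem_union, Finset.mem_image, Finset.mem_range, Finset.mem_filter,
        Finset.mem_product, Finset.mem_sigma, hg1, hg2, hg3, Prod.mk.injEq]
      constructor
      · rintro ⟨⟨ha, hb, hc⟩, h⟩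
        by_cases hx : b % 2 = 0
        · by_cases hy : c ≤ 2 * k
          · exact Or.inl (Or.inr ⟨⟨(2 * k - c).toNat, ((b - 2) / 2).toNat⟩, by
              dsimp only; omega, by dsimp only; omega⟩)
          · exact Or.inr ⟨⟨((4 * k - c) / 2).toNat, ((b - 2) / 2).toNat⟩, by
              dsimp only; omega, by dsimp only; omega⟩
        · exact Or.inl (Or.inl ⟨⟨((a - 1) / 2).toNat, ((b - 1) / 2).toNat⟩, by
              dsimp only; omega, by dsimp only; omega⟩)
      · rintro ((⟨⟨i, j⟩, hi, h⟩ | ⟨⟨i, j⟩, hi, h⟩) | ⟨⟨i, j⟩, hi, h⟩) <;>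
          dsimp only at hi h <;> omega
    rw [h, Finset.card_union_of_disjoint, Finset.card_union_of_disjoint,
      aux_card_sigma, aux_card_sigma, aux_card_sigma, Finset.sum_add_distrib]
    · have e1 := aux_gauss k
      have e2 := aux_gauss (2 * k)
      have e3 : ((∑ i ∈ Finset.range k, 2 * i : ℕ) : ℝ) = k * (k - 1) := by
        rw [← Finset.mul_sum, Nat.cast_mul, e1]; push_cast; ring
      rw [Nat.cast_add, Nat.cast_add, Nat.cast_add, e3, e1, e2]
      simp only [Finset.sum_const, Finset.card_range, smul_eq_mul]
      push_cast; ring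
    · intro i j i' j' h; simp only [hg3, Prod.mk.injEq] at h; omega
    · intro i j i' j' h; simp only [hg2, Prod.mk.injEq] at h; omega
    · intro i j i' j' h; simp only [hg1, Prod.mk.injEq] at h; omega
    · rw [Finset.disjoint_left]
      simp only [Finset.mem_image, Finset.mem_sigma, Finset.mem_range]
      rintro x ⟨⟨i, j⟩, hi, rfl⟩ ⟨⟨i', j'⟩, hj, h⟩
      simp only [hg1, hg2, Prod.mk.injEq] at h hi hj
      omega
    · rw [Finset.disjoint_left]
      simp only [Finset.mem_union, Finset.mem_image, Finset.mem_sigma, Finset.mem_range]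
      rintro x (⟨⟨i, j⟩, hi, rfl⟩ | ⟨⟨i, j⟩, hi, rfl⟩) ⟨⟨i', j'⟩, hj, h⟩ <;>
      simp only [hg1, hg2, hg3, Prod.mk.injEq] at h hi hj <;>
      omega
  rw [hT, hcard]
  push_cast
  refine ⟨by ring, by ring, by ring⟩
end
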